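/- Suppose G contains a contracting element and the action G ↷ Y is of divergent type. Then every infinite normal subgroup H of G satisfies ω_H > ω_G/2. -/

import Mathlib

open Metric Filter Topology Set MeasureTheory Pointwise

noncomputable section

namespace ConfDyn

/-- `γ` is (the image of) a geodesic segment from `x` to `y`. -/
def IsGeodesicIn (Y : Type*) [MetricSpace Y] (γ : Set Y) (x y : Y) : Prop :=
  ∃ f : ℝ → Y, f 0 = x ∧ f (dist x y) = y ∧
    (∀ s ∈ Set.Icc (0 : ℝ) (dist x y), ∀ t ∈ Set.Icc (0 : ℝ) (dist x y),
      dist (f s) (f t) = |s - t|) ∧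
    γ = f '' Set.Icc (0 : ℝ) (dist x y)

/-- `Y` is a geodesic metric space. -/
def GeodesicSpace (Y : Type*) [MetricSpace Y] : Prop :=
  ∀ x y : Y, ∃ γ : Set Y, IsGeodesicIn Y γ x y

/-- the shortest projection of the point `y` to the subset `X`. -/
def projSet {Y : Type*} [MetricSpace Y] (X : Set Y) (y : Y) : Set Y :=
  {x ∈ X | dist y x = Metric.infDist y X}

/-- the shortest projection of the subset `A` to the subset `X`. -/
def projSetOf {Y : Type*} [MetricSpace Y] (X A : Set Y) : Set Y :=
  ⋃ a ∈ A, projSet X a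

/-- `d_X(x,y)`, the diameter of `π_X(x) ∪ π_X(y)`. -/
def projDist {Y : Type*} [MetricSpace Y] (X : Set Y) (x y : Y) : ENNReal :=
  EMetric.diam (projSet X x ∪ projSet X y)

/-- `X` is a `C`-contracting subset: any geodesic segment at distance at least `C`
from `X` has shortest projection to `X` of diameter at most `C`. -/
def IsContractingSet {Y : Type*} [MetricSpace Y] (C : ℝ) (X : Set Y) : Prop :=
  ∀ x y : Y, ∀ γ : Set Y, IsGeodesicIn Y γ x y →
    (∀ p ∈ γ, C ≤ Metric.infDist p X) →
    EMetric.diam (projSetOf X γ) ≤ ENNReal.ofReal C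

/-- the Busemann function based at `o` associated to `y`, `b_y(x) = d(x,y) - d(o,y)`. -/
def busemannCM {Y : Type*} [MetricSpace Y] (o y : Y) : C(Y, ℝ) :=
  ⟨fun x => dist x y - dist o y,
    (continuous_id.dist continuous_const).sub continuous_const⟩

/-- the horofunction compactification of `Y`: the closure of `{b_y : y ∈ Y}` in
`C(Y,ℝ)` with the compact-open topology. -/
def horoCpt (Y : Type*) [MetricSpace Y] (o : Y) : Set C(Y, ℝ) :=
  closure (Set.range (busemannCM o))

/-- `ξ` is a point of the horofunction boundary `∂_h Y`. -/
def IsHoroPoint {Y : Type*} [MetricSpace Y] (o : Y) (ξ : C(Y, ℝ)) : Prop :=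
  ξ ∈ horoCpt Y o ∧ ∀ y : Y, ξ ≠ busemannCM o y

/-- a sequence of points of `Y` converges to `ξ` in the horofunction compactification. -/
def HoroConv {Y : Type*} [MetricSpace Y] (o : Y) (u : ℕ → Y) (ξ : C(Y, ℝ)) : Prop :=
  Filter.Tendsto (fun n => busemannCM o (u n)) atTop (nhds ξ)

/-- two horofunctions have (K-)finite difference for some K. -/
def FinDiff {Y : Type*} [MetricSpace Y] (ξ η : C(Y, ℝ)) : Prop :=
  ∃ K : ℝ, ∀ z : Y, |ξ z - η z| ≤ K

/-- the locus of a subset of the horofunction boundary. -/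
def locus {Y : Type*} [MetricSpace Y] (o : Y) (Λ : Set C(Y, ℝ)) : Set C(Y, ℝ) :=
  {η | IsHoroPoint o η ∧ ∃ ξ ∈ Λ, FinDiff ξ η}

/-- the finite-difference relation as a setoid on `C(Y,ℝ)`. -/
def finDiffSetoid (Y : Type*) [MetricSpace Y] : Setoid C(Y, ℝ) where
  r := FinDiff
  iseqv := ⟨fun ξ => ⟨0, fun z => by simp⟩,
    fun h => h.imp (fun K hK z => by rw [abs_sub_comm]; exact hK z),
    fun h₁ h₂ => by
      obtain ⟨K₁, hK₁⟩ := h₁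
      obtain ⟨K₂, hK₂⟩ := h₂
      exact ⟨K₁ + K₂, fun z => (abs_sub_le _ _ _).trans (add_le_add (hK₁ z) (hK₂ z))⟩⟩

/-- the limit set of a subset `X ⊆ Y` in the horofunction boundary. -/
def limitSetOf {Y : Type*} [MetricSpace Y] (o : Y) (X : Set Y) : Set C(Y, ℝ) :=
  {ξ | IsHoroPoint o ξ ∧ ∃ u : ℕ → Y, (∀ n, u n ∈ X) ∧ HoroConv o u ξ}

/-- accumulation points of a sequence of points of `Y` in the horofunction boundary. -/
def accPoints {Y : Type*} [MetricSpace Y] (o : Y) (u : ℕ → Y) : Set C(Y, ℝ) :=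
  {ξ | IsHoroPoint o ξ ∧ ∃ φ : ℕ → ℕ, StrictMono φ ∧ HoroConv o (u ∘ φ) ξ}

/-- `X` is a quasi-geodesic: the image of a quasi-isometric embedding of a real interval. -/
def IsQuasiGeodesicSet {Y : Type*} [MetricSpace Y] (X : Set Y) : Prop :=
  ∃ (c : ℝ) (I : Set ℝ) (φ : ℝ → Y), 1 ≤ c ∧ I.OrdConnected ∧ X = φ '' I ∧
    ∀ s ∈ I, ∀ t ∈ I,
      (1 / c) * |s - t| - c ≤ dist (φ s) (φ t) ∧ dist (φ s) (φ t) ≤ c * |s - t| + c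

section GroupAction

variable {Y : Type*} [MetricSpace Y] {G : Type*} [Group G] [MulAction G Y]

/-- `G` acts by isometries on `Y`. -/
def IsometricAction (G Y : Type*) [Group G] [MulAction G Y] [MetricSpace Y] : Prop :=
  ∀ g : G, Isometry (fun y : Y => g • y)

/-- the action of `G` on `Y` is (metrically) proper. -/
def ProperAction (G Y : Type*) [Group G] [MulAction G Y] [MetricSpace Y] : Prop :=
  ∀ B : Set Y, Bornology.IsBounded B → Set.Finite {g : G | (g • B) ∩ B ≠ ∅}

/-- `G` is non-elementary: no finite-index subgroup is trivial or infinite cyclic. -/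
def NonElementary (G : Type*) [Group G] : Prop :=
  ∀ H : Subgroup G, H.index ≠ 0 → ∀ g : G, H ≠ Subgroup.zpowers g

/-- the orbit of `o` under the cyclic group generated by `f`. -/
def cyclicOrbit (o : Y) (f : G) : Set Y :=
  {y : Y | ∃ n : ℤ, y = f ^ n • o}

/-- `f` is a contracting element with `C`-contracting orbit: it has infinite order,
`n ↦ fⁿ • o` is a quasi-isometric embedding of `ℤ`, and `⟨f⟩ • o` is `C`-contracting. -/
def IsContractingElt (o : Y) (C : ℝ) (f : G) : Prop :=
  (∀ n : ℤ, n ≠ 0 → f ^ n ≠ 1) ∧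
  (∃ c : ℝ, 1 ≤ c ∧ ∀ m n : ℤ,
      (1 / c) * |(m : ℝ) - (n : ℝ)| - c ≤ dist (f ^ m • o) (f ^ n • o) ∧
      dist (f ^ m • o) (f ^ n • o) ≤ c * |(m : ℝ) - (n : ℝ)| + c) ∧
  IsContractingSet C (cyclicOrbit o f)

/-- `f` is a contracting element. -/
def IsContractingEltAny (o : Y) (f : G) : Prop :=
  ∃ C : ℝ, 1 ≤ C ∧ IsContractingElt o C f

/-- the elementary group `E(f)`: elements moving `⟨f⟩ • o` a finite Hausdorff distance. -/
def EGroup (o : Y) (f : G) : Set G :=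
  {g : G | EMetric.hausdorffEdist (g • cyclicOrbit o f) (cyclicOrbit o f) ≠ ⊤}

/-- the axis `Ax(f) = E(f) • o`. -/
def axisOf (o : Y) (f : G) : Set Y :=
  (fun g : G => g • o) '' EGroup o f

/-- the family of all `G`-translated axes of `h` and `k`. -/
def axesPairFam (o : Y) (h k : G) : Set (Set Y) :=
  {S | ∃ g : G, S = g • axisOf o h ∨ S = g • axisOf o k}

/-- `h` and `k` are independent contracting elements: the family of their translated
axes has bounded projection. -/
def IndepElts (o : Y) (h k : G) : Prop :=
  ∃ B : ℝ, 0 < B ∧ ∀ U ∈ axesPairFam o h k, ∀ V ∈ axesPairFam o h k,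
    U ≠ V → EMetric.diam (projSetOf U V) ≤ ENNReal.ofReal B

/-- the family of all `G`-translated axes of the triple `f₁, f₂, f₃`. -/
def axesTripleFam (o : Y) (f₁ f₂ f₃ : G) : Set (Set Y) :=
  {S | ∃ g : G, S = g • axisOf o f₁ ∨ S = g • axisOf o f₂ ∨ S = g • axisOf o f₃}

/-- `F = {f₁,f₂,f₃}` is an admissible triple with constants `C`, `B₀`: three pairwise
independent contracting elements whose translated axes are `C`-contracting with
`B₀`-bounded projection. -/
def IsAdmissibleTriple (o : Y) (C B₀ : ℝ) (f₁ f₂ f₃ : G) : Prop :=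
  f₁ ≠ f₂ ∧ f₁ ≠ f₃ ∧ f₂ ≠ f₃ ∧
  IsContractingEltAny o f₁ ∧ IsContractingEltAny o f₂ ∧ IsContractingEltAny o f₃ ∧
  IndepElts o f₁ f₂ ∧ IndepElts o f₁ f₃ ∧ IndepElts o f₂ f₃ ∧
  (∀ S ∈ axesTripleFam o f₁ f₂ f₃, IsContractingSet C S) ∧
  (∀ U ∈ axesTripleFam o f₁ f₂ f₃, ∀ V ∈ axesTripleFam o f₁ f₂ f₃,
    U ≠ V → EMetric.diam (projSetOf U V) ≤ ENNReal.ofReal B₀)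

/-- the geodesic `γ` contains an `(r,f)`-barrier at `g • o`. -/
def HasBarrier (o : Y) (r : ℝ) (f g : G) (γ : Set Y) : Prop :=
  Metric.infDist (g • o) γ ≤ r ∧ Metric.infDist ((g * f) • o) γ ≤ r

/-- the partial cone `Ω_x^F(g • o, r)`. -/
def partialCone (o x : Y) (f₁ f₂ f₃ : G) (g : G) (r : ℝ) : Set Y :=
  {z | ∃ γ : Set Y, IsGeodesicIn Y γ x z ∧
      (HasBarrier o r f₁ g γ ∨ HasBarrier o r f₂ g γ ∨ HasBarrier o r f₃ g γ)}

/-- the partial shadow `Π_x^F(g • o, r)`: accumulation points of the partial cone in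
the horofunction boundary. -/
def partialShadow (o x : Y) (f₁ f₂ f₃ : G) (g : G) (r : ℝ) : Set C(Y, ℝ) :=
  {ξ | IsHoroPoint o ξ ∧ ∃ u : ℕ → Y, (∀ n, u n ∈ partialCone o x f₁ f₂ f₃ g r) ∧
      HoroConv o u ξ}

/-- `ξ` is an `(r,F)`-conical point. -/
def IsConicalPt (o : Y) (f₁ f₂ f₃ : G) (r : ℝ) (ξ : C(Y, ℝ)) : Prop :=
  ∃ g₀ : G, Set.Infinite {g : G | ξ ∈ partialShadow o (g₀ • o) f₁ f₂ f₃ g r}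

/-- the usual cone `Ω_x(y,r)`. -/
def usualCone (x y : Y) (r : ℝ) : Set Y :=
  {z | ∃ γ : Set Y, IsGeodesicIn Y γ x z ∧ ∃ p ∈ γ, dist p y ≤ r}

/-- the usual shadow `Π_x(y,r)`. -/
def usualShadow (o x y : Y) (r : ℝ) : Set C(Y, ℝ) :=
  {ξ | IsHoroPoint o ξ ∧ ∃ u : ℕ → Y, (∀ n, u n ∈ usualCone x y r) ∧ HoroConv o u ξ}

/-- the set `Λ_c(G)` of conical points of the action. -/
def conicalSet (G : Type*) {Y : Type*} [Group G] [MulAction G Y] [MetricSpace Y]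
    (o : Y) : Set C(Y, ℝ) :=
  {ξ | ∃ r : ℝ, 0 < r ∧ ∃ g₀ : G, ∃ u : ℕ → G,
      Filter.Tendsto (fun n => dist o (u n • o)) atTop atTop ∧
      ∀ n, ξ ∈ usualShadow o (g₀ • o) (u n • o) r}

/-- the attracting fixed-point set `[h⁺]`: the locus of the accumulation points of
`{hⁿ o : n > 0}` in the horofunction boundary. -/
def attrFix (o : Y) (h : G) : Set C(Y, ℝ) :=
  locus o (accPoints o (fun n : ℕ => h ^ (n + 1) • o))

/-- the repelling fixed-point set `[h⁻]`. -/
def repFix (o : Y) (h : G) : Set C(Y, ℝ) :=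
  locus o (accPoints o (fun n : ℕ => h ^ (-(n + 1) : ℤ) • o))

/-- the limit set `Λ G y` of the orbit `G • y` in the horofunction boundary. -/
def orbitLimitSet (G : Type*) {Y : Type*} [Group G] [MulAction G Y] [MetricSpace Y]
    (o y : Y) : Set C(Y, ℝ) :=
  {ξ | IsHoroPoint o ξ ∧ ∃ u : ℕ → G,
      Filter.Tendsto (fun n => busemannCM o (u n • y)) atTop (nhds ξ)}

/-- the action of an isometry `g` on horofunctions. -/
def horoAct [ContinuousConstSMul G Y] (o : Y) (g : G) (ξ : C(Y, ℝ)) : C(Y, ℝ) :=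
  ⟨fun y => ξ (g⁻¹ • y) - ξ (g⁻¹ • o),
    (ξ.continuous.comp (continuous_const_smul g⁻¹)).sub continuous_const⟩

/-- the number of orbit points of `Γ ⊆ G` in the closed ball of radius `R` around `o`. -/
def orbitCount (G : Type*) {Y : Type*} [Group G] [MulAction G Y] [MetricSpace Y]
    (o : Y) (Γ : Set G) (R : ℝ) : ℕ :=
  Nat.card {g : G // g ∈ Γ ∧ dist o (g • o) ≤ R}

/-- the critical exponent `ω_Γ` of a subset `Γ ⊆ G`. -/
def critExp (G : Type*) {Y : Type*} [Group G] [MulAction G Y] [MetricSpace Y]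
    (o : Y) (Γ : Set G) : ℝ :=
  Filter.limsup (fun R : ℝ => Real.log (orbitCount G o Γ R) / R) atTop

/-- an `ω`-dimensional `G`-equivariant conformal density on the horofunction boundary:
a family of finite measures supported on `∂_h Y`, normalized at `o`, `G`-equivariant,
with conformal derivative `dμ_x/dμ_y(ξ) = e^{-ω·B_ξ(x,y)}`. -/
def IsConformalDensity (G : Type*) {Y : Type*} [Group G] [MulAction G Y] [MetricSpace Y]
    [ContinuousConstSMul G Y] [MeasurableSpace C(Y, ℝ)]
    (o : Y) (ω : ℝ) (μ : Y → MeasureTheory.Measure C(Y, ℝ)) : Prop :=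
  (∀ x : Y, MeasureTheory.IsFiniteMeasure (μ x)) ∧
  (∀ x : Y, μ x {ξ : C(Y, ℝ) | ¬ IsHoroPoint o ξ} = 0) ∧
  μ o Set.univ = 1 ∧
  (∀ g : G, ∀ x : Y, MeasureTheory.Measure.map (horoAct o g) (μ x) = μ (g • x)) ∧
  (∀ x y : Y, μ x = (μ y).withDensity
      (fun ξ : C(Y, ℝ) => ENNReal.ofReal (Real.exp (-ω * (ξ x - ξ y)))))

end GroupAction

section Projection

variable {Y : Type*} [MetricSpace Y]

/-- `f` restricted to `[0, L]` is a unit speed geodesic. -/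
def IsUnitSpeed (f : ℝ → Y) (L : ℝ) : Prop :=
  0 ≤ L ∧ ∀ s ∈ Icc (0 : ℝ) L, ∀ t ∈ Icc (0 : ℝ) L, dist (f s) (f t) = |s - t|

theorem IsUnitSpeed.shift {f : ℝ → Y} {L s t : ℝ} (hf : IsUnitSpeed f L) (hs : 0 ≤ s)
    (hst : s ≤ t) (ht : t ≤ L) : IsUnitSpeed (fun x => f (s + x)) (t - s) := by
  refine ⟨by linarith, fun u hu v hv => ?_⟩
  simp only [mem_Icc] at hu hv
  rw [hf.2 _ ⟨by linarith, by linarith⟩ _ ⟨by linarith, by linarith⟩]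
  congr 1
  ring

theorem IsUnitSpeed.reverse {f : ℝ → Y} {L : ℝ} (hf : IsUnitSpeed f L) :
    IsUnitSpeed (fun x => f (L - x)) L := by
  refine ⟨hf.1, fun u hu v hv => ?_⟩
  simp only [mem_Icc] at hu hv
  rw [hf.2 _ ⟨by linarith, by linarith⟩ _ ⟨by linarith, by linarith⟩, abs_sub_comm]
  congr 1
  ring

theorem IsUnitSpeed.dist_of_le {f : ℝ → Y} {L s t : ℝ} (hf : IsUnitSpeed f L) (hs : 0 ≤ s)
    (hst : s ≤ t) (ht : t ≤ L) : dist (f s) (f t) = t - s := by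
  rw [hf.2 s ⟨hs, hst.trans ht⟩ t ⟨hs.trans hst, ht⟩, abs_sub_comm, abs_of_nonneg (by linarith)]

theorem GeodesicSpace.exists_isUnitSpeed (hY : GeodesicSpace Y) (x y : Y) :
    ∃ f : ℝ → Y, IsUnitSpeed f (dist x y) ∧ f 0 = x ∧ f (dist x y) = y := by
  obtain ⟨_, f, h0, h1, hf, -⟩ := hY x y
  exact ⟨f, ⟨dist_nonneg, hf⟩, h0, h1⟩

/-- Pointwise form of the contraction property: the endpoints of a geodesic staying at distance
at least `C` from `X` have `C`-close projections. -/
def Contracts (C : ℝ) (X : Set Y) : Prop :=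
  ∀ (f : ℝ → Y) (L : ℝ), IsUnitSpeed f L → (∀ t ∈ Icc (0 : ℝ) L, C ≤ infDist (f t) X) →
    ∀ a ∈ projSet X (f 0), ∀ b ∈ projSet X (f L), dist a b ≤ C

theorem IsContractingSet.contracts {C : ℝ} {X : Set Y} (hC : 0 ≤ C) (h : IsContractingSet C X) :
    Contracts C X := by
  intro f L hf hfar a ha b hb
  have hL : dist (f 0) (f L) = L := by
    simpa using hf.dist_of_le le_rfl hf.1 le_rfl
  have hgeo : IsGeodesicIn Y (f '' Icc 0 L) (f 0) (f L) :=
    ⟨f, rfl, by rw [hL], by rw [hL]; exact hf.2, by rw [hL]⟩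
  have hdiam := h _ _ _ hgeo (by rintro _ ⟨t, ht, rfl⟩; exact hfar t ht)
  have mem : ∀ t ∈ Icc (0 : ℝ) L, ∀ c ∈ projSet X (f t), c ∈ projSetOf X (f '' Icc 0 L) :=
    fun t ht c hc => mem_iUnion₂.2 ⟨f t, ⟨t, ht, rfl⟩, hc⟩
  have := (Metric.edist_le_ediam_of_mem (mem 0 ⟨le_rfl, hf.1⟩ a ha)
    (mem L ⟨hf.1, le_rfl⟩ b hb)).trans hdiam
  rwa [edist_dist, ENNReal.ofReal_le_ofReal_iff hC] at this

variable {C : ℝ} {X : Set Y}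

theorem dist_le_of_mem_projSet {x a : Y} {r : ℝ} (ha : a ∈ projSet X x) (hx : infDist x X ≤ r) :
    dist x a ≤ r :=
  ha.2.trans_le hx

theorem exists_mem_projSet [ProperSpace Y] (hX : IsClosed X) (hne : X.Nonempty) (x : Y) :
    ∃ a, a ∈ projSet X x := by
  obtain ⟨a, ha, h⟩ := hX.exists_infDist_eq_dist hne x
  exact ⟨a, ha, h.symm⟩

/-- A geodesic that comes `C`-close to a contracting set leaves its `C`-neighbourhood for the last
time at a point having almost the same projection as the endpoint. -/
theorem Contracts.exists_last (hX : Contracts C X) (hC : 0 ≤ C) {f : ℝ → Y} {L : ℝ}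
    (hf : IsUnitSpeed f L) (hne : ∃ t ∈ Icc (0 : ℝ) L, infDist (f t) X ≤ C) :
    ∃ t ∈ Icc (0 : ℝ) L, infDist (f t) X ≤ C ∧
      ∀ a ∈ projSet X (f t), ∀ b ∈ projSet X (f L), dist a b ≤ 2 * C := by
  have hcont : ContinuousOn (fun t => infDist (f t) X) (Icc 0 L) := by
    refine (continuous_infDist_pt X).comp_continuousOn (Metric.continuousOn_iff.2 ?_)
    intro b hb ε hε
    exact ⟨ε, hε, fun a ha hab => by rwa [hf.2 a ha b hb, ← Real.dist_eq]⟩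
  have hcpt : IsCompact (Icc (0 : ℝ) L ∩ (fun t => infDist (f t) X) ⁻¹' Iic C) :=
    isCompact_Icc.of_isClosed_subset
      (hcont.preimage_isClosed_of_isClosed isClosed_Icc isClosed_Iic) inter_subset_left
  obtain ⟨t, ⟨ht, htC⟩, hmax⟩ := hcpt.exists_isGreatest (by
    obtain ⟨t, ht, h⟩ := hne
    exact ⟨t, ht, h⟩)
  refine ⟨t, ht, htC, fun a ha b hb => ?_⟩
  have htC' : infDist (f t) X ≤ C := htC
  rcases eq_or_lt_of_le ht.2 with rfl | hlt
  · have h1 := dist_le_of_mem_projSet ha htC'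
    have h2 := dist_le_of_mem_projSet hb htC'
    linarith [dist_triangle_left a b (f t)]
  have hgt : ∀ u ∈ Icc (0 : ℝ) L, t < u → C < infDist (f u) X := by
    intro u hu htu
    by_contra! hle
    exact absurd (hmax ⟨hu, hle⟩) (not_le.2 htu)
  have hge : C ≤ infDist (f t) X := by
    refine le_of_forall_pos_le_add fun ε hε => ?_
    set δ := min ε (L - t)
    have hδ : 0 < δ := lt_min hε (by linarith)
    have hδ' : t + δ ≤ L := by linarith [min_le_right ε (L - t)]
    have h1 := hgt (t + δ) ⟨by linarith [ht.1], hδ'⟩ (by linarith)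
    have h2 := infDist_le_infDist_add_dist (s := X) (x := f (t + δ)) (y := f t)
    rw [dist_comm, hf.dist_of_le ht.1 (by linarith) hδ'] at h2
    linarith [min_le_left ε (L - t)]
  have := hX _ _ (hf.shift ht.1 ht.2 le_rfl) (fun u hu => by
    rcases eq_or_lt_of_le hu.1 with rfl | hu0
    · simpa using hge
    · exact (hgt _ ⟨by linarith [ht.1], by linarith [hu.2]⟩ (by linarith)).le) a (by simpa using ha)
      b (by simpa using hb)
  linarith

theorem Contracts.exists_first (hX : Contracts C X) (hC : 0 ≤ C) {f : ℝ → Y} {L : ℝ}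
    (hf : IsUnitSpeed f L) (hne : ∃ t ∈ Icc (0 : ℝ) L, infDist (f t) X ≤ C) :
    ∃ t ∈ Icc (0 : ℝ) L, infDist (f t) X ≤ C ∧
      ∀ a ∈ projSet X (f t), ∀ b ∈ projSet X (f 0), dist a b ≤ 2 * C := by
  obtain ⟨t, ht, h, hd⟩ := hX.exists_last hC hf.reverse (by
    obtain ⟨t, ht, h⟩ := hne
    exact ⟨L - t, ⟨by linarith [ht.2], by linarith [ht.1]⟩, by simpa using h⟩)
  exact ⟨L - t, ⟨by linarith [ht.2], by linarith [ht.1]⟩, h, by simpa using hd⟩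

/-- Either a geodesic avoids the `C`-neighbourhood, or its endpoints have close projections. -/
theorem Contracts.exists_infDist_le (hX : Contracts C X) {f : ℝ → Y} {L : ℝ}
    (hf : IsUnitSpeed f L) {a b : Y} (ha : a ∈ projSet X (f 0)) (hb : b ∈ projSet X (f L))
    (hab : C < dist a b) : ∃ t ∈ Icc (0 : ℝ) L, infDist (f t) X ≤ C := by
  by_contra! h
  exact absurd (hX f L hf (fun t ht => (h t ht).le) a ha b hb) (not_le.2 hab)

theorem Contracts.exists_dist_left_le [ProperSpace Y] (hX : Contracts C X) (hC : 0 ≤ C)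
    (hcl : IsClosed X) {f : ℝ → Y} {L : ℝ} (hf : IsUnitSpeed f L) {a b : Y}
    (ha : a ∈ projSet X (f 0)) (hb : b ∈ projSet X (f L)) (hab : C < dist a b) :
    ∃ t ∈ Icc (0 : ℝ) L, dist (f t) a ≤ 3 * C := by
  obtain ⟨t, ht, h1, h2⟩ := hX.exists_first hC hf (hX.exists_infDist_le hf ha hb hab)
  obtain ⟨c, hc⟩ := exists_mem_projSet hcl ⟨a, ha.1⟩ (f t)
  refine ⟨t, ht, ?_⟩
  linarith [dist_triangle (f t) c a, h2 c hc a ha, dist_le_of_mem_projSet hc h1]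

/-- A geodesic with endpoints on a contracting set stays close to it. -/
theorem Contracts.infDist_le [ProperSpace Y] (hX : Contracts C X) (hC : 0 ≤ C)
    (hcl : IsClosed X) {f : ℝ → Y} {L : ℝ} (hf : IsUnitSpeed f L) (h0 : f 0 ∈ X) (hL : f L ∈ X)
    {t : ℝ} (ht : t ∈ Icc (0 : ℝ) L) : infDist (f t) X ≤ 4 * C := by
  obtain ⟨c, hc⟩ := exists_mem_projSet hcl ⟨_, h0⟩ (f t)
  have hl : IsUnitSpeed f t := by simpa using hf.shift le_rfl ht.1 ht.2
  obtain ⟨u, hu, hu1, hu2⟩ := hX.exists_last hC hl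
    ⟨0, ⟨le_rfl, ht.1⟩, by rw [infDist_zero_of_mem h0]; exact hC⟩
  obtain ⟨v, hv, hv1, hv2⟩ := hX.exists_first hC (hf.shift ht.1 ht.2 le_rfl)
    ⟨L - t, ⟨by linarith [ht.2], le_rfl⟩, by
      simp only [add_sub_cancel]
      rw [infDist_zero_of_mem hL]
      exact hC⟩
  obtain ⟨a, ha⟩ := exists_mem_projSet hcl ⟨_, h0⟩ (f u)
  obtain ⟨b, hb⟩ := exists_mem_projSet hcl ⟨_, h0⟩ (f (t + v))
  have e1 := hu2 a ha c hc
  have e2 := hv2 b hb c (by simpa using hc)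
  have e3 := dist_le_of_mem_projSet ha hu1
  have e4 := dist_le_of_mem_projSet hb hv1
  have e5 : dist (f u) (f (t + v)) = t + v - u :=
    hf.dist_of_le hu.1 (by linarith [hu.2, hv.1]) (by linarith [hv.2])
  have e6 : dist (f u) (f (t + v)) ≤ 6 * C := by
    have := dist_triangle4 (f u) a c (f (t + v))
    have := dist_triangle c b (f (t + v))
    rw [dist_comm c b, dist_comm b (f (t + v))] at this
    linarith
  have e7 : dist (f t) (f u) = t - u := by
    rw [dist_comm]; exact hf.dist_of_le hu.1 hu.2 ht.2
  have e8 : dist (f t) (f (t + v)) = v := by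
    rw [hf.dist_of_le ht.1 (by linarith [hv.1]) (by linarith [hv.2])]; ring
  have i1 := infDist_le_infDist_add_dist (s := X) (x := f t) (y := f u)
  have i2 := infDist_le_infDist_add_dist (s := X) (x := f t) (y := f (t + v))
  linarith

/-- Projections to contracting sets are coarsely Lipschitz. -/
theorem Contracts.dist_proj_le (hY : GeodesicSpace Y) (hX : Contracts C X) (hC : 0 ≤ C)
    {x y a b : Y} (ha : a ∈ projSet X x) (hb : b ∈ projSet X y) :
    dist a b ≤ 2 * C + 2 * dist x y := by
  obtain ⟨f, hf, rfl, hy⟩ := hY.exists_isUnitSpeed x y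
  set L := dist (f 0) y
  by_contra! hlt
  have hL : 0 ≤ L := hf.1
  obtain ⟨t, ht, h⟩ := hX.exists_infDist_le hf ha (by rw [hy]; exact hb) (by linarith)
  have i1 := infDist_le_infDist_add_dist (s := X) (x := f 0) (y := f t)
  have i2 := infDist_le_infDist_add_dist (s := X) (x := f L) (y := f t)
  rw [hf.dist_of_le le_rfl ht.1 ht.2] at i1
  rw [dist_comm, hf.dist_of_le ht.1 ht.2 le_rfl, hy] at i2
  have := dist_triangle4 a (f 0) y b
  rw [dist_comm a (f 0), ha.2, hb.2] at this
  linarith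

/-- Behrstock inequality for two contracting sets with bounded projections to each other. -/
theorem Contracts.behrstock [ProperSpace Y] (hY : GeodesicSpace Y) {U V : Set Y}
    (hU : Contracts C U) (hV : Contracts C V) (hC : 0 ≤ C) (hUc : IsClosed U) (hVc : IsClosed V)
    {u₀ v₀ : Y} {B : ℝ}
    (hVU : ∀ v ∈ V, ∀ u ∈ projSet U v, dist u u₀ ≤ B)
    (hUV : ∀ u ∈ U, ∀ v ∈ projSet V u, dist v v₀ ≤ B) (z : Y) :
    (∀ u ∈ projSet U z, dist u u₀ ≤ B + 8 * C) ∨ (∀ v ∈ projSet V z, dist v v₀ ≤ B + 8 * C) := by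
  by_contra! h
  obtain ⟨⟨u, hu, hu'⟩, v, hv, hv'⟩ := h
  obtain ⟨f, hf, rfl, hy⟩ := hY.exists_isUnitSpeed z v
  set L := dist (f 0) v with hLdef
  obtain ⟨u', hu1⟩ := exists_mem_projSet hUc ⟨u, hu.1⟩ v
  have hu2 := hVU v hv.1 u' hu1
  have hd : C < dist u u' := by linarith [dist_triangle u u' u₀]
  obtain ⟨t, ht, h⟩ := hU.exists_dist_left_le hC hUc hf hu (by rw [hy]; exact hu1) hd
  have hvt : v ∈ projSet V (f t) := by
    refine ⟨hv.1, le_antisymm ?_ (infDist_le_dist_of_mem hv.1)⟩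
    have e1 : dist (f t) v = L - t := by
      rw [← hy]; exact hf.dist_of_le ht.1 ht.2 le_rfl
    have e2 := infDist_le_infDist_add_dist (s := V) (x := f 0) (y := f t)
    rw [hf.dist_of_le le_rfl ht.1 ht.2, ← hv.2] at e2
    linarith
  obtain ⟨v', hv1⟩ := exists_mem_projSet hVc ⟨v, hv.1⟩ u
  have e3 := hV.dist_proj_le hY hC hvt hv1
  have e4 := hUV u hu.1 v' hv1
  linarith [dist_triangle v v' v₀]

end Projection

section Action

variable {Y : Type*} [MetricSpace Y] {G : Type*} [Group G] [MulAction G Y]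

theorem ProperAction.finite_dist_le (hprop : ProperAction G Y) (o : Y) (R : ℝ) :
    {g : G | dist o (g • o) ≤ R}.Finite := by
  rcases lt_or_ge R 0 with hR | hR
  · convert Set.finite_empty (α := G)
    exact eq_empty_of_forall_notMem fun g hg => absurd (dist_nonneg.trans hg) (not_le.2 hR)
  refine (hprop (closedBall o R) isBounded_closedBall).subset fun g hg => ?_
  exact (Set.nonempty_iff_ne_empty.1 ⟨g • o, smul_mem_smul_set (mem_closedBall_self hR),
    by rw [mem_closedBall, dist_comm]; exact hg⟩)

/-- The elements commensurating the cyclic group generated by `f`. -/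
def commensurating (f : G) : Subgroup G where
  carrier := {g | ∃ m n : ℤ, m ≠ 0 ∧ n ≠ 0 ∧ g * f ^ m * g⁻¹ = f ^ n}
  one_mem' := ⟨1, 1, one_ne_zero, one_ne_zero, by simp⟩
  mul_mem' := by
    rintro a b ⟨m, n, hm, hn, h⟩ ⟨m', n', hm', hn', h'⟩
    refine ⟨m' * m, n * n', mul_ne_zero hm' hm, mul_ne_zero hn hn', ?_⟩
    calc a * b * f ^ (m' * m) * (a * b)⁻¹ = a * (b * f ^ m' * b⁻¹) ^ m * a⁻¹ := by
          rw [conj_zpow, zpow_mul]; group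
      _ = (a * f ^ m * a⁻¹) ^ n' := by
          rw [h', conj_zpow, ← zpow_mul, ← zpow_mul, mul_comm]
      _ = f ^ (n * n') := by rw [h, zpow_mul]
  inv_mem' := by
    rintro a ⟨m, n, hm, hn, h⟩
    exact ⟨n, m, hn, hm, by rw [← h]; group⟩

theorem mem_commensurating {f g : G} :
    g ∈ commensurating f ↔ ∃ m n : ℤ, m ≠ 0 ∧ n ≠ 0 ∧ g * f ^ m * g⁻¹ = f ^ n := Iff.rfl

theorem zpow_mem_commensurating (f : G) (n : ℤ) : f ^ n ∈ commensurating f :=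
  ⟨1, 1, one_ne_zero, one_ne_zero, by group⟩

theorem zpow_smul_mem_cyclicOrbit (o : Y) (f : G) (n : ℤ) : f ^ n • o ∈ cyclicOrbit o f :=
  ⟨n, rfl⟩

theorem self_mem_cyclicOrbit (o : Y) (f : G) : o ∈ cyclicOrbit o f := ⟨0, by simp⟩

theorem zpow_smul_cyclicOrbit (o : Y) (f : G) (n : ℤ) :
    f ^ n • cyclicOrbit o f = cyclicOrbit o f := by
  ext y
  rw [mem_smul_set_iff_inv_smul_mem]
  constructor
  · rintro ⟨m, hm⟩
    exact ⟨n + m, by rw [zpow_add, mul_smul, ← hm, smul_inv_smul]⟩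
  · rintro ⟨m, rfl⟩
    exact ⟨-n + m, by rw [zpow_add, mul_smul, zpow_neg]⟩

theorem IsContractingElt.zpow_ne_zpow {o : Y} {C : ℝ} {f : G} (h : IsContractingElt o C f)
    {m n : ℤ} (hmn : m ≠ n) : f ^ m ≠ f ^ n := fun he =>
  h.1 (m - n) (sub_ne_zero.2 hmn) (by rw [zpow_sub, he, mul_inv_cancel])

theorem IsContractingElt.exists_lt_dist {o : Y} {C : ℝ} {f : G} (h : IsContractingElt o C f)
    (R : ℝ) {n : ℤ} (hn : n ≠ 0) : ∃ k : ℤ, R < dist (f ^ (n * k) • o) o := by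
  obtain ⟨c, hc, hq⟩ := h.2.1
  obtain ⟨k, hk⟩ := exists_nat_gt (c * (R + c))
  refine ⟨k, ?_⟩
  have h1 := (hq (n * k) 0).1
  rw [zpow_zero, one_smul] at h1
  have h2 : (k : ℝ) ≤ |((n * k : ℤ) : ℝ) - ((0 : ℤ) : ℝ)| := by
    push_cast
    rw [sub_zero, abs_mul, abs_of_nonneg (Nat.cast_nonneg (α := ℝ) k)]
    have : (1 : ℝ) ≤ |(n : ℝ)| := by exact_mod_cast Int.one_le_abs hn
    nlinarith [Nat.cast_nonneg (α := ℝ) k]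
  have h3 : R + c < 1 / c * |((n * k : ℤ) : ℝ) - ((0 : ℤ) : ℝ)| := by
    rw [one_div, inv_mul_eq_div, lt_div_iff₀ (by linarith)]
    linarith [mul_comm c (R + c)]
  linarith

theorem isClosed_cyclicOrbit (hprop : ProperAction G Y) (o : Y) {C : ℝ} {f : G}
    (h : IsContractingElt o C f) : IsClosed (cyclicOrbit o f) := by
  have : cyclicOrbit o f = ⋃ n : ℤ, {f ^ n • o} := by
    ext y; simp [cyclicOrbit, eq_comm]
  rw [this]
  refine LocallyFinite.isClosed_iUnion (fun y => ⟨ball y 1, ball_mem_nhds y one_pos, ?_⟩)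
    fun n => isClosed_singleton
  refine Set.Finite.of_finite_image
    ((hprop.finite_dist_le o (dist o y + 1)).subset ?_)
    (f := fun n : ℤ => f ^ n) ?_
  · rintro _ ⟨n, ⟨z, hz, hz'⟩, rfl⟩
    rw [mem_singleton_iff] at hz
    subst hz
    exact (dist_triangle_right _ _ y).trans (by
      rw [mem_ball] at hz'
      linarith)
  · intro m _ n _ hmn
    by_contra hne
    exact h.zpow_ne_zpow hne hmn

variable [IsIsometricSMul G Y]

theorem infDist_smul_set (g : G) (y : Y) (X : Set Y) : infDist (g • y) (g • X) = infDist y X :=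
  infDist_image (isometry_smul Y g)

theorem smul_mem_projSet {g : G} {X : Set Y} {a y : Y} :
    g • a ∈ projSet (g • X) (g • y) ↔ a ∈ projSet X y := by
  simp only [projSet, mem_sep_iff, smul_mem_smul_set_iff, dist_smul, infDist_smul_set]

theorem mem_projSet_smul {g : G} {X : Set Y} {a y : Y} :
    a ∈ projSet (g • X) y ↔ g⁻¹ • a ∈ projSet X (g⁻¹ • y) := by
  have := smul_mem_projSet (g := g) (X := X) (a := g⁻¹ • a) (y := g⁻¹ • y)
  rwa [smul_inv_smul, smul_inv_smul] at this

theorem IsUnitSpeed.smul {f : ℝ → Y} {L : ℝ} (hf : IsUnitSpeed f L) (g : G) :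
    IsUnitSpeed (fun t => g • f t) L :=
  ⟨hf.1, fun s hs t ht => by rw [dist_smul, hf.2 s hs t ht]⟩

theorem Contracts.smul {C : ℝ} {X : Set Y} (h : Contracts C X) (g : G) :
    Contracts C (g • X) := by
  intro f L hf hfar a ha b hb
  rw [← dist_smul g⁻¹ a b]
  refine h _ L (hf.smul g⁻¹) (fun t ht => ?_) _ (mem_projSet_smul.1 ha) _ (mem_projSet_smul.1 hb)
  rw [← infDist_smul_set g, smul_inv_smul]
  exact hfar t ht

variable [ProperSpace Y] {o : Y} {C : ℝ} {f : G}

/-- If only finitely many points of `g⟨f⟩o` are close to `⟨f⟩o`, then the projection of `g⟨f⟩o`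
is bounded. -/
theorem IsContractingElt.exists_bound_of_finite (hY : GeodesicSpace Y)
    (hprop : ProperAction G Y) (hC : 0 ≤ C) (hf : IsContractingElt o C f) (g : G)
    (hfin : {b : ℤ | ∃ i : ℤ, dist (f ^ i • o) (g • f ^ b • o) ≤ 5 * C + 1}.Finite) :
    ∃ R : ℝ, ∀ y ∈ g • cyclicOrbit o f, ∀ a ∈ projSet (cyclicOrbit o f) y, dist a o ≤ R := by
  set X := cyclicOrbit o f with hXdef
  have hX : Contracts C X := hf.2.2.contracts hC
  have hcl : IsClosed X := isClosed_cyclicOrbit hprop o hf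
  have hne : X.Nonempty := ⟨o, self_mem_cyclicOrbit o f⟩
  obtain ⟨M, hM⟩ := (hfin.image fun b : ℤ => dist (g • f ^ b • o) o).bddAbove
  obtain ⟨a₀, ha₀⟩ := exists_mem_projSet hcl hne (g • o)
  refine ⟨max (C + dist a₀ o) (7 * C + 1 + M), ?_⟩
  intro y hy a ha
  obtain ⟨φ, hφ, h0, h1⟩ := hY.exists_isUnitSpeed (g • o) y
  set L := dist (g • o) y
  rw [← h0] at ha₀
  rw [← h1] at ha
  rcases le_or_gt (dist a₀ a) C with hle | hlt
  · refine le_max_of_le_left ?_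
    linarith [dist_triangle_left a o a₀]
  refine le_max_of_le_right ?_
  obtain ⟨t, ht, ht1, ht2⟩ := hX.exists_last hC hφ (hX.exists_infDist_le hφ ha₀ ha hlt)
  obtain ⟨c, hc⟩ := exists_mem_projSet hcl hne (φ t)
  have hcl' : IsClosed (g • X) := hcl.smul g
  have hq := (hX.smul g).infDist_le hC hcl' hφ
    (by rw [h0]; exact smul_mem_smul_set (self_mem_cyclicOrbit o f)) (by rw [h1]; exact hy) ht
  obtain ⟨z, hz⟩ := exists_mem_projSet hcl' ⟨y, hy⟩ (φ t)
  have hz1 := dist_le_of_mem_projSet hz hq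
  obtain ⟨_, ⟨k, rfl⟩, rfl⟩ := hz.1
  have hc1 := dist_le_of_mem_projSet hc ht1
  obtain ⟨i, rfl⟩ := hc.1
  have hd : dist (f ^ i • o) (g • f ^ k • o) ≤ 5 * C := by
    have := dist_triangle_left (f ^ i • o) (g • f ^ k • o) (φ t)
    linarith
  have hk : dist (g • f ^ k • o) o ≤ M := hM ⟨k, ⟨i, by linarith⟩, rfl⟩
  have := dist_triangle4 a (f ^ i • o) (g • f ^ k • o) o
  have := ht2 _ hc a ha
  rw [dist_comm] at this
  linarith

theorem IsContractingElt.exists_bound (hY : GeodesicSpace Y)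
    (hprop : ProperAction G Y) (hC : 0 ≤ C) (hf : IsContractingElt o C f) {g : G}
    (hg : g ∉ commensurating f) :
    ∃ R : ℝ, ∀ y ∈ g • cyclicOrbit o f, ∀ a ∈ projSet (cyclicOrbit o f) y, dist a o ≤ R := by
  refine hf.exists_bound_of_finite hY hprop hC g ?_
  by_contra hinf
  choose! i hi using fun (b : ℤ)
    (hb : ∃ i : ℤ, dist (f ^ i • o) (g • f ^ b • o) ≤ 5 * C + 1) => hb
  obtain ⟨b, hb, b', hb', hne, heq⟩ := Set.Infinite.exists_ne_map_eq_of_mapsTo hinf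
    (f := fun b => (f ^ i b)⁻¹ * g * f ^ b) (fun b hb => by
      have := hi b hb
      rw [← dist_smul (f ^ i b)⁻¹, inv_smul_smul] at this
      simpa [mul_smul] using this) (hprop.finite_dist_le o (5 * C + 1))
  have hconj : g * f ^ (b - b') * g⁻¹ = f ^ (i b - i b') := by
    calc g * f ^ (b - b') * g⁻¹
        = f ^ i b * ((f ^ i b)⁻¹ * g * f ^ b) * f ^ (-b') * g⁻¹ := by
          rw [zpow_sub, zpow_neg]; group
      _ = f ^ (i b - i b') := by
          rw [heq, zpow_sub]; group
  refine hg ⟨b - b', i b - i b', sub_ne_zero.2 hne, fun h0 => ?_, hconj⟩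
  rw [h0, zpow_zero, mul_inv_eq_one, mul_eq_left] at hconj
  exact hf.1 _ (sub_ne_zero.2 hne) hconj

/-- The cyclic group generated by a contracting element has finite index in its commensurator. -/
theorem IsContractingElt.exists_finite_cosets (hY : GeodesicSpace Y)
    (hprop : ProperAction G Y) (hC : 0 ≤ C) (hf : IsContractingElt o C f) :
    ∃ T : Set G, T.Finite ∧ ∀ g ∈ commensurating f, ∃ k : ℤ, ∃ t ∈ T, g = f ^ k * t := by
  have key : ∀ g ∈ commensurating f, ∃ i a : ℤ,
      dist o ((f ^ i * g * f ^ a) • o) ≤ 5 * C + 1 := by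
    intro g hg
    by_contra! hall
    obtain ⟨R, hR⟩ := hf.exists_bound_of_finite hY hprop hC g (by
      convert Set.finite_empty (α := ℤ)
      refine eq_empty_of_forall_notMem fun b => ?_
      rintro ⟨i, hi⟩
      refine absurd hi (not_le.2 ?_)
      rw [← dist_smul (f ^ (-i))]
      simpa [mul_smul] using hall (-i) b)
    obtain ⟨m, n, hm, hn, hmn⟩ := mem_commensurating.1 hg
    obtain ⟨a₀, ha₀⟩ := exists_mem_projSet (isClosed_cyclicOrbit hprop o hf)
      ⟨o, self_mem_cyclicOrbit o f⟩ (g • o)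
    obtain ⟨k, hk⟩ := hf.exists_lt_dist (R + dist a₀ o) hn
    have hgk : f ^ (n * k) * g = g * f ^ (m * k) := by
      rw [zpow_mul, ← hmn, conj_zpow, zpow_mul]; group
    have h1 := (smul_mem_projSet (g := f ^ (n * k))).2 ha₀
    rw [zpow_smul_cyclicOrbit, ← mul_smul, hgk, mul_smul] at h1
    have h2 := hR _ (smul_mem_smul_set (zpow_smul_mem_cyclicOrbit o f _)) _ h1
    have h3 := dist_triangle (f ^ (n * k) • o) (f ^ (n * k) • a₀) o
    rw [dist_smul, dist_comm o] at h3
    linarith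
  have hfin := hprop.finite_dist_le o (5 * C + 1)
  have hP : ∀ b : G, ∃ P q : ℤ, b ∈ commensurating f → P ≠ 0 ∧ b * f ^ P * b⁻¹ = f ^ q := by
    intro b
    by_cases hb : b ∈ commensurating f
    · obtain ⟨m, n, hm, -, h⟩ := mem_commensurating.1 hb
      exact ⟨m, n, fun _ => ⟨hm, h⟩⟩
    · exact ⟨0, 0, fun h => absurd h hb⟩
  choose P q hPq using hP
  refine ⟨⋃ b ∈ {g : G | dist o (g • o) ≤ 5 * C + 1},
    (fun j : ℤ => b * f ^ j) '' Set.Icc 0 |P b|,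
    hfin.biUnion fun b _ => (Set.finite_Icc _ _).image _, fun g hg => ?_⟩
  obtain ⟨i, a, hia⟩ := key g hg
  set b := f ^ i * g * f ^ a
  have hb : b ∈ commensurating f :=
    mul_mem (mul_mem (zpow_mem_commensurating f i) hg) (zpow_mem_commensurating f a)
  obtain ⟨hP0, hPb⟩ := hPq b hb
  refine ⟨-i + q b * ((-a) / P b), b * f ^ ((-a) % P b), mem_iUnion₂.2 ⟨b, hia,
    (-a) % P b, ⟨Int.emod_nonneg _ hP0, (Int.emod_lt_abs _ hP0).le⟩, rfl⟩, ?_⟩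
  have h1 : f ^ (q b * ((-a) / P b)) * b = b * f ^ (P b * ((-a) / P b)) := by
    rw [zpow_mul, ← hPb, conj_zpow, zpow_mul]; group
  calc g = f ^ (-i) * (b * f ^ (-a)) := by simp only [b, zpow_neg]; group
    _ = f ^ (-i) * (b * f ^ (P b * ((-a) / P b) + (-a) % P b)) := by
        rw [Int.mul_ediv_add_emod]
    _ = f ^ (-i) * (f ^ (q b * ((-a) / P b)) * b * f ^ ((-a) % P b)) := by
        rw [h1, zpow_add]; group
    _ = _ := by rw [zpow_add]; group

theorem IsContractingElt.exists_zpow_eq (hY : GeodesicSpace Y)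
    (hprop : ProperAction G Y) (hC : 0 ≤ C) (hf : IsContractingElt o C f) {e : G}
    (he : e ∈ commensurating f) (hord : ∀ n : ℤ, n ≠ 0 → e ^ n ≠ 1) :
    ∃ n k : ℤ, n ≠ 0 ∧ k ≠ 0 ∧ e ^ n = f ^ k := by
  obtain ⟨T, hT, hcos⟩ := hf.exists_finite_cosets hY hprop hC
  choose k t ht heq using fun n : ℤ => hcos (e ^ n) (zpow_mem he n)
  obtain ⟨m, -, n, -, hne, hmn⟩ := Set.Infinite.exists_ne_map_eq_of_mapsTo
    (Set.infinite_univ (α := ℤ)) (f := t) (fun n _ => ht n) hT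
  have h1 : e ^ (m - n) = f ^ (k m - k n) := by
    rw [zpow_sub, heq m, heq n, hmn, zpow_sub]; group
  refine ⟨m - n, k m - k n, sub_ne_zero.2 hne, fun h0 => ?_, h1⟩
  exact hord _ (sub_ne_zero.2 hne) (by rw [h1, h0, zpow_zero])

/-- If a nontrivial power of `f` is conjugated by `g` into the commensurator of `f`, then `g`
commensurates `f`. -/
theorem IsContractingElt.mem_commensurating_of_conj (hY : GeodesicSpace Y)
    (hprop : ProperAction G Y) (hC : 0 ≤ C) (hf : IsContractingElt o C f) {g : G} {d : ℤ}
    (hd : d ≠ 0) (h : g * f ^ d * g⁻¹ ∈ commensurating f) : g ∈ commensurating f := by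
  obtain ⟨n, k, hn, hk, hnk⟩ := hf.exists_zpow_eq hY hprop hC h (fun n hn h1 => by
    rw [conj_zpow, mul_inv_eq_one, mul_eq_left, ← zpow_mul] at h1
    exact hf.1 _ (mul_ne_zero hd hn) h1)
  exact ⟨d * n, k, mul_ne_zero hd hn, hk, by rw [← hnk, conj_zpow, zpow_mul]⟩

/-- An infinite normal subgroup of a non-elementary group is not contained in the commensurator
of a contracting element. -/
theorem IsContractingElt.exists_mem_notMem_commensurating (hY : GeodesicSpace Y)
    (hprop : ProperAction G Y) (hne : NonElementary G) (hC : 0 ≤ C) (hf : IsContractingElt o C f)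
    {H : Subgroup G} (hnorm : H.Normal) (hinf : (H : Set G).Infinite) :
    ∃ h ∈ H, h ∉ commensurating f := by
  by_contra! hle
  obtain ⟨T, hT, hcos⟩ := hf.exists_finite_cosets hY hprop hC
  choose! k t ht heq using hcos
  obtain ⟨x, hx, y, hy, hxy, htxy⟩ := hinf.exists_ne_map_eq_of_mapsTo
    (f := t) (fun x hx => ht x (hle x hx)) hT
  have h1 : x * y⁻¹ = f ^ (k x - k y) := by
    nth_rewrite 1 [heq x (hle x hx), heq y (hle y hy)]
    rw [htxy, zpow_sub]; group
  have hd : k x - k y ≠ 0 := fun h0 => hxy (by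
    rw [h0, zpow_zero, mul_inv_eq_one] at h1
    exact h1)
  have hmem : f ^ (k x - k y) ∈ H := h1 ▸ H.mul_mem hx (H.inv_mem hy)
  have hall : ∀ g : G, g ∈ commensurating f := fun g =>
    hf.mem_commensurating_of_conj hY hprop hC hd (hle _ (hnorm.conj_mem _ hmem g))
  refine hne (Subgroup.zpowers f) ?_ f rfl
  have : Finite (G ⧸ Subgroup.zpowers f) := by
    have := hT.to_subtype
    refine Finite.of_surjective (fun s : T => (((s : G)⁻¹ : G) : G ⧸ Subgroup.zpowers f)) ?_
    intro x
    induction x using QuotientGroup.induction_on with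
    | H g =>
      refine ⟨⟨t g⁻¹, ht _ (hall _)⟩, ?_⟩
      refine QuotientGroup.eq.2 (Subgroup.mem_zpowers_iff.2 ⟨-k g⁻¹, ?_⟩)
      have h2 := eq_mul_inv_of_mul_eq (heq g⁻¹ (hall _)).symm
      rw [zpow_neg, h2]
      group
  exact Subgroup.index_ne_zero_of_finite

theorem IsContractingElt.exists_three (hY : GeodesicSpace Y)
    (hprop : ProperAction G Y) (hne : NonElementary G) (hC : 0 ≤ C) (hf : IsContractingElt o C f)
    {H : Subgroup G} (hnorm : H.Normal) (hinf : (H : Set G).Infinite) :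
    ∃ h : Fin 3 → G, (∀ i, h i ∈ H) ∧ ∀ i j, i ≠ j → (h i)⁻¹ * h j ∉ commensurating f := by
  obtain ⟨h, hH, hE⟩ := hf.exists_mem_notMem_commensurating hY hprop hne hC hnorm hinf
  refine ⟨fun i => f ^ (i : ℤ) * h * (f ^ (i : ℤ))⁻¹, fun i => hnorm.conj_mem _ hH _, ?_⟩
  intro i j hij hmem
  have hd : ((j : ℕ) : ℤ) - (i : ℕ) ≠ 0 := by
    intro h0
    exact hij (Fin.ext (by omega))
  have hz := zpow_mem_commensurating f
  have h1 := mul_mem (mul_mem (hz (-(i : ℕ))) hmem) (hz (j : ℕ))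
  refine hE ((commensurating f).inv_mem_iff.1
    (hf.mem_commensurating_of_conj hY hprop hC (g := h⁻¹) hd ?_))
  convert h1 using 1
  rw [zpow_sub, zpow_neg]
  group

/-- Away from the commensurator, a point cannot project far on two translates of the axis. -/
theorem IsContractingElt.exists_behrstock (hY : GeodesicSpace Y)
    (hprop : ProperAction G Y) (hC : 0 ≤ C) (hf : IsContractingElt o C f) {k : G}
    (hk : k ∉ commensurating f) :
    ∃ B : ℝ, ∀ z : Y, (∀ a ∈ projSet (cyclicOrbit o f) z, dist a o ≤ B) ∨
      (∀ a ∈ projSet (cyclicOrbit o f) (k⁻¹ • z), dist a o ≤ B) := by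
  have hX : Contracts C (cyclicOrbit o f) := hf.2.2.contracts hC
  have hcl : IsClosed (cyclicOrbit o f) := isClosed_cyclicOrbit hprop o hf
  obtain ⟨R, hR⟩ := hf.exists_bound hY hprop hC hk
  obtain ⟨R', hR'⟩ := hf.exists_bound hY hprop hC (g := k⁻¹) (by simpa using hk)
  refine ⟨max R R' + 8 * C, fun z => ?_⟩
  rcases hX.behrstock hY (hX.smul k) hC hcl (hcl.smul k) (u₀ := o) (v₀ := k • o)
    (B := max R R') (fun v hv u hu => (hR v hv u hu).trans (le_max_left _ _))
    (fun u hu v hv => by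
      refine le_trans ?_ (le_max_right R R')
      rw [← dist_smul k⁻¹, inv_smul_smul]
      exact hR' _ (smul_mem_smul_set hu) _ (mem_projSet_smul.1 hv)) z with h | h
  · exact Or.inl h
  · refine Or.inr fun a ha => ?_
    rw [← dist_smul k]
    exact h _ (by rwa [mem_projSet_smul, inv_smul_smul])

end Action

section Extension

/-- A proper length function on a group. -/
structure IsProperLength {G : Type*} [Group G] (l : G → ℝ) : Prop where
  nonneg : ∀ g, 0 ≤ l g
  map_inv : ∀ g, l g⁻¹ = l g
  map_mul_le : ∀ g h, l (g * h) ≤ l g + l h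
  finite_le : ∀ R, {g | l g ≤ R}.Finite

/-- A system of separators for a length function: between any two elements `g`, `k` of `G` one can
insert `sep g k`, taken from a finite subset of `H`, such that the product `g * sep g k * k` is
almost geodesic. The set `near w` consists of elements lying close to a geodesic from `1` to
`w`. -/
structure Separators {G : Type*} [Group G] (H : Subgroup G) (l : G → ℝ) where
  /-- The error constant. -/
  K : ℝ
  /-- The separator inserted between two elements. -/
  sep : G → G → G
  /-- The finite set of separators. -/
  F : Finset G
  /-- The elements close to a geodesic from `1` to a given element. -/
  near : G → Set G
  sep_mem : ∀ g k, sep g k ∈ F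
  mem_of_mem : ∀ a ∈ F, a ∈ H
  le_of_mem : ∀ a ∈ F, l a ≤ K
  mem_near : ∀ g k, g ∈ near (g * sep g k * k)
  mem_near_mul : ∀ g k m, g ∈ near (g * sep g k * k * sep (g * sep g k * k) m * m)
  add_le_of_mem_near : ∀ w, ∀ u ∈ near w, ∀ v ∈ near w, ∀ t, 0 ≤ t → l u ≤ l v + t →
    l u + l (u⁻¹ * v) + l (v⁻¹ * w) ≤ l w + K + 2 * t

variable {Y : Type*} [MetricSpace Y] {G : Type*} [Group G] [MulAction G Y]
  [IsIsometricSMul G Y]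

theorem isProperLength_dist (hprop : ProperAction G Y) (o : Y) :
    IsProperLength fun g : G => dist o (g • o) where
  nonneg _ := dist_nonneg
  map_inv g := by rw [← dist_smul g, smul_inv_smul, dist_comm]
  map_mul_le g h := by
    refine (dist_triangle o (g • o) _).trans ?_
    rw [mul_smul, dist_smul]
  finite_le := hprop.finite_dist_le o

variable [ProperSpace Y] {o : Y} {C : ℝ} {f : G}

/-- Any two points project close to `o` on a common translate, among three independent ones. -/
theorem IsContractingElt.exists_common (hY : GeodesicSpace Y) (hprop : ProperAction G Y)
    (hC : 0 ≤ C) (hf : IsContractingElt o C f) {h : Fin 3 → G}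
    (hh : ∀ i j, i ≠ j → (h i)⁻¹ * h j ∉ commensurating f) :
    ∃ B : ℝ, ∀ z w : Y, ∃ i, (∀ a ∈ projSet (cyclicOrbit o f) ((h i)⁻¹ • z), dist a o ≤ B) ∧
      ∀ a ∈ projSet (cyclicOrbit o f) ((h i)⁻¹ • w), dist a o ≤ B := by
  have hB : ∀ p : Fin 3 × Fin 3, ∃ B : ℝ, p.1 ≠ p.2 → ∀ z : Y,
      (∀ a ∈ projSet (cyclicOrbit o f) ((h p.1)⁻¹ • z), dist a o ≤ B) ∨
      ∀ a ∈ projSet (cyclicOrbit o f) ((h p.2)⁻¹ • z), dist a o ≤ B := by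
    rintro ⟨i, j⟩
    by_cases hij : i = j
    · exact ⟨0, fun h => absurd hij h⟩
    obtain ⟨B, hB⟩ := hf.exists_behrstock hY hprop hC (hh i j hij)
    refine ⟨B, fun _ z => ?_⟩
    simpa [mul_smul] using hB ((h i)⁻¹ • z)
  choose B hB using hB
  obtain ⟨M, hM⟩ := (Set.finite_range B).bddAbove
  have key : ∀ z : Y, ∀ i j, i ≠ j →
      (∀ a ∈ projSet (cyclicOrbit o f) ((h i)⁻¹ • z), dist a o ≤ M) ∨
      ∀ a ∈ projSet (cyclicOrbit o f) ((h j)⁻¹ • z), dist a o ≤ M := fun z i j hij =>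
    (hB (i, j) hij z).imp (fun h a ha => (h a ha).trans (hM ⟨_, rfl⟩))
      fun h a ha => (h a ha).trans (hM ⟨_, rfl⟩)
  refine ⟨M, fun z w => ?_⟩
  by_contra! hcon
  have h01 := key z 0 1 (by decide)
  have h02 := key z 0 2 (by decide)
  have h12 := key z 1 2 (by decide)
  have k01 := key w 0 1 (by decide)
  have k02 := key w 0 2 (by decide)
  have k12 := key w 1 2 (by decide)
  have c : ∀ i, (∀ a ∈ projSet (cyclicOrbit o f) ((h i)⁻¹ • z), dist a o ≤ M) →
      ¬ ∀ a ∈ projSet (cyclicOrbit o f) ((h i)⁻¹ • w), dist a o ≤ M := fun i hi hw => by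
    obtain ⟨a, ha, ha'⟩ := hcon i hi
    exact absurd (hw a ha) (not_le.2 ha')
  have c0 := c 0
  have c1 := c 1
  have c2 := c 2
  tauto

/-- Extension lemma: finitely many elements of `H` suffice to make all concatenations almost
geodesic. -/
theorem IsContractingElt.exists_extension (hY : GeodesicSpace Y) (hprop : ProperAction G Y)
    (hne : NonElementary G) (hC : 0 ≤ C) (hf : IsContractingElt o C f)
    {H : Subgroup G} (hnorm : H.Normal) (hinf : (H : Set G).Infinite) :
    ∃ (r : ℝ) (F : Finset G), 0 ≤ r ∧ (∀ a ∈ F, a ∈ H) ∧ ∀ g k : G, ∃ a ∈ F, ∀ (φ : ℝ → Y) (L : ℝ),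
      IsUnitSpeed φ L → φ 0 = o → dist (φ L) ((g * a * k) • o) ≤ r →
        ∃ t ∈ Icc 0 L, dist (φ t) (g • o) ≤ r := by
  classical
  obtain ⟨h, hH, hh⟩ := hf.exists_three hY hprop hne hC hnorm hinf
  obtain ⟨B, hB⟩ := hf.exists_common hY hprop hC hh
  obtain ⟨M, hM⟩ := (Set.finite_range fun i => dist (h i • o) o).bddAbove
  have hX : Contracts C (cyclicOrbit o f) := hf.2.2.contracts hC
  have hcl : IsClosed (cyclicOrbit o f) := isClosed_cyclicOrbit hprop o hf
  have hne' : (cyclicOrbit o f).Nonempty := ⟨o, self_mem_cyclicOrbit o f⟩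
  set r := 3 * C + |B| + |M|
  obtain ⟨n, hn⟩ := hf.exists_lt_dist (2 * B + (2 * C + 2 * r) + C) one_ne_zero
  rw [one_mul] at hn
  refine ⟨r, Finset.univ.image fun i => h i * (f ^ n * (h i)⁻¹ * (f ^ n)⁻¹), by positivity, ?_, ?_⟩
  · simp only [Finset.mem_image, Finset.mem_univ, true_and, forall_exists_index]
    rintro _ i rfl
    exact H.mul_mem (hH i) (hnorm.conj_mem _ (H.inv_mem (hH i)) _)
  intro g k
  obtain ⟨i, hi1, hi2⟩ := hB (g⁻¹ • o) ((f ^ n)⁻¹ • k • o)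
  refine ⟨_, Finset.mem_image_of_mem _ (Finset.mem_univ i), fun φ L hφ h0 hL => ?_⟩
  set ψ : ℝ → Y := fun t => (g * h i)⁻¹ • φ t
  have hψ : IsUnitSpeed ψ L := hφ.smul _
  obtain ⟨a, ha⟩ := exists_mem_projSet hcl hne' (ψ 0)
  obtain ⟨b, hb⟩ := exists_mem_projSet hcl hne' (ψ L)
  obtain ⟨c, hc⟩ := exists_mem_projSet hcl hne' ((h i)⁻¹ • (f ^ n)⁻¹ • k • o)
  have ha' : dist a o ≤ B := hi1 a (by
    simpa [ψ, h0, mul_smul] using ha)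
  have hc' := hi2 c hc
  have hc2 : f ^ n • c ∈ projSet (cyclicOrbit o f) (f ^ n • (h i)⁻¹ • (f ^ n)⁻¹ • k • o) := by
    have := (smul_mem_projSet (g := f ^ n)).2 hc
    rwa [zpow_smul_cyclicOrbit] at this
  have hbc := hX.dist_proj_le hY hC hb hc2
  have hd : dist (ψ L) (f ^ n • (h i)⁻¹ • (f ^ n)⁻¹ • k • o) ≤ r := by
    rw [← dist_smul (g * h i)]
    simpa [ψ, mul_smul] using hL
  have hab : C < dist a b := by
    have h1 := dist_triangle4 (f ^ n • o) (f ^ n • c) b o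
    have h2 := dist_triangle_left b o a
    rw [dist_smul, dist_comm o c, dist_comm _ b] at h1
    linarith
  obtain ⟨t, ht, hta⟩ := hX.exists_dist_left_le hC hcl hψ ha hb hab
  refine ⟨t, ht, ?_⟩
  have h1 : dist (φ t) ((g * h i) • o) ≤ 3 * C + B := by
    rw [← dist_smul (g * h i)⁻¹, inv_smul_smul]
    linarith [dist_triangle (ψ t) a o]
  have h2 : dist ((g * h i) • o) (g • o) ≤ M := by
    rw [mul_smul, dist_smul]
    exact hM ⟨i, rfl⟩
  linarith [dist_triangle (φ t) ((g * h i) • o) (g • o), le_abs_self B, le_abs_self M]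

theorem IsContractingElt.nonempty_separators (hY : GeodesicSpace Y) (hprop : ProperAction G Y)
    (hne : NonElementary G) (hC : 0 ≤ C) (hf : IsContractingElt o C f)
    {H : Subgroup G} (hnorm : H.Normal) (hinf : (H : Set G).Infinite) :
    Nonempty (Separators H fun g : G => dist o (g • o)) := by
  obtain ⟨r, F, hr, hFH, hext⟩ := hf.exists_extension hY hprop hne hC hnorm hinf
  choose sep hsep hext using hext
  obtain ⟨M, hM⟩ := (F.finite_toSet.image fun a : G => dist o (a • o)).bddAbove
  choose γ hγ hγ0 hγ1 using fun w : G => hY.exists_isUnitSpeed o (w • o)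
  refine ⟨⟨max M (8 * r), sep, F, fun w => {u | ∃ t ∈ Icc 0 (dist o (w • o)),
    dist (γ w t) (u • o) ≤ r}, hsep, hFH, fun a ha => (hM ⟨a, ha, rfl⟩).trans (le_max_left _ _),
    fun g k => ?_, fun g k m => ?_, ?_⟩⟩
  · exact hext g k _ _ (hγ _) (hγ0 _) (by rw [hγ1, dist_self]; exact hr)
  · set w := g * sep g k * k * sep (g * sep g k * k) m * m
    obtain ⟨t, ht, htr⟩ := hext (g * sep g k * k) m _ _ (hγ w) (hγ0 _)
      (by rw [hγ1, dist_self]; exact hr)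
    have hsub : IsUnitSpeed (γ w) t := by
      simpa using (hγ w).shift le_rfl ht.1 ht.2
    obtain ⟨t', ht', htr'⟩ := hext g k _ _ hsub (hγ0 _) htr
    exact ⟨t', ⟨ht'.1, ht'.2.trans ht.2⟩, htr'⟩
  · rintro w u ⟨s, hs, hsu⟩ v ⟨s', hs', hsv⟩ t ht huv
    have hK : 8 * r ≤ max M (8 * r) := le_max_right _ _
    have d0 : dist o (γ w s) = s := by
      rw [← hγ0 w, (hγ w).dist_of_le le_rfl hs.1 hs.2, sub_zero]
    have d0' : dist o (γ w s') = s' := by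
      rw [← hγ0 w, (hγ w).dist_of_le le_rfl hs'.1 hs'.2, sub_zero]
    have d1 : dist (γ w s') (w • o) = dist o (w • o) - s' := by
      have := (hγ w).dist_of_le hs'.1 hs'.2 le_rfl
      rwa [hγ1] at this
    have d2 := (hγ w).2 s hs s' hs'
    have e1 := dist_triangle o (γ w s) (u • o)
    have e2 := dist_triangle_right o (γ w s) (u • o)
    have e3 := dist_triangle o (γ w s') (v • o)
    have e4 := dist_triangle4 (u • o) (γ w s) (γ w s') (v • o)
    have e5 := dist_triangle_left (v • o) (w • o) (γ w s')
    have f1 : dist o ((u⁻¹ * v) • o) = dist (u • o) (v • o) := by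
      rw [← dist_smul u, mul_smul, smul_inv_smul]
    have f2 : dist o ((v⁻¹ * w) • o) = dist (v • o) (w • o) := by
      rw [← dist_smul v, mul_smul, smul_inv_smul]
    rw [dist_comm (u • o) (γ w s)] at e4
    rw [f1, f2]
    rcases abs_cases (s - s') with h | h <;> linarith

end Extension

section Sums

open scoped ENNReal

theorem tsum_le_of_fiber {α β γ : Type*} (p : α → β) (q : α → α → γ) (J : Finset γ)
    {u : α → ℝ≥0∞} {v : β → ℝ≥0∞} {c : ℝ≥0∞} (huv : ∀ a, u a ≤ c * v (p a))
    (hq : ∀ a b, p a = p b → q a b ∈ J)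
    (hinj : ∀ a b b', p a = p b → p a = p b' → q a b = q a b' → b = b') :
    ∑' a, u a ≤ J.card * c * ∑' b, v b := by
  rw [← ENNReal.tsum_fiberwise u p, ← ENNReal.tsum_mul_left]
  refine ENNReal.tsum_le_tsum fun x => ?_
  calc ∑' b : p ⁻¹' {x}, u b ≤ ∑' _ : p ⁻¹' {x}, c * v x :=
        ENNReal.tsum_le_tsum fun b => by
          have hb : p b = x := b.2
          exact (huv b).trans_eq (by rw [hb])
    _ = (p ⁻¹' {x}).encard * (c * v x) := ENNReal.tsum_set_const _ _
    _ ≤ J.card * (c * v x) := by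
        gcongr
        have h : (p ⁻¹' {x}).encard ≤ (J : Set γ).encard := by
          rcases (p ⁻¹' {x}).eq_empty_or_nonempty with he | ⟨a, ha⟩
          · simp [he]
          · exact Set.encard_le_encard_of_injOn (f := q a)
              (fun b hb => hq a b (ha.trans hb.symm))
              fun b hb b' hb' h => hinj a b b' (ha.trans hb.symm) (ha.trans hb'.symm) h
        rw [Set.encard_coe_eq_coe_finsetCard] at h
        exact_mod_cast ENat.toENNReal_le.2 h
    _ = _ := by rw [mul_assoc]

/-- A form of the Cauchy-Schwarz inequality. -/
theorem tsum_comp_le_collision {T κ : Type*} (W : T → κ) (x : κ → ℝ≥0∞) {c : ℝ≥0∞}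
    (hc : c ≠ 0) (hc' : c ≠ ∞) :
    ∑' t, x (W t) ≤ c * ∑' w, x w + c⁻¹ * ∑' p : {p : T × T | W p.1 = W p.2}, x (W p.1.1) := by
  classical
  set V : κ → ℝ≥0∞ := fun w => ∑' t, if W t = w then 1 else 0
  have hV : ∀ y : κ → ℝ≥0∞, ∑' t, y (W t) = ∑' w, V w * y w := fun y => by
    simp only [V, ← ENNReal.tsum_mul_right]
    rw [ENNReal.tsum_comm]
    refine tsum_congr fun t => ?_
    rw [tsum_eq_single (W t) fun w hw => by simp [hw.symm]]
    simp
  have hQ : ∑' p : {p : T × T | W p.1 = W p.2}, x (W p.1.1) = ∑' w, V w * (V w * x w) := by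
    rw [tsum_subtype {p : T × T | W p.1 = W p.2} fun p => x (W p.1), ← hV fun w => V w * x w,
      ENNReal.tsum_prod (f := fun a b =>
        ({p : T × T | W p.1 = W p.2}.indicator (fun p => x (W p.1)) (a, b)))]
    refine tsum_congr fun t => ?_
    simp only [V, ← ENNReal.tsum_mul_right]
    refine tsum_congr fun t' => ?_
    by_cases h : W t = W t'
    · simp [h]
    · simp [h, Ne.symm h]
  rw [hQ, hV x, ← ENNReal.tsum_mul_left, ← ENNReal.tsum_mul_left, ← ENNReal.tsum_add]
  refine ENNReal.tsum_le_tsum fun w => ?_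
  rcases le_total (V w) c with h | h
  · exact le_add_right (by gcongr)
  · refine le_add_left ?_
    calc V w * x w = c⁻¹ * (c * (V w * x w)) := by
          rw [← mul_assoc, ENNReal.inv_mul_cancel hc hc', one_mul]
      _ ≤ _ := by gcongr

theorem tsum_mul_tsum {α β : Type*} (u : α → ℝ≥0∞) (v : β → ℝ≥0∞) :
    (∑' a, u a) * ∑' b, v b = ∑' p : α × β, u p.1 * v p.2 := by
  rw [ENNReal.tsum_prod (f := fun a b => u a * v b), ← ENNReal.tsum_mul_right]
  exact tsum_congr fun a => ENNReal.tsum_mul_left.symm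

/-- The exponential, as an extended nonnegative real. -/
def eexp (x : ℝ) : ℝ≥0∞ := ENNReal.ofReal (Real.exp x)

theorem eexp_add (x y : ℝ) : eexp (x + y) = eexp x * eexp y := by
  rw [eexp, Real.exp_add, ENNReal.ofReal_mul (Real.exp_pos _).le, eexp, eexp]

theorem eexp_ne_top (x : ℝ) : eexp x ≠ ∞ := ENNReal.ofReal_ne_top

theorem eexp_le {x y : ℝ} (h : x ≤ y) : eexp x ≤ eexp y :=
  ENNReal.ofReal_le_ofReal (Real.exp_le_exp.2 h)

theorem eexp_le_mul {s S c x y : ℝ} (hs : 0 ≤ s) (hS : s ≤ S) (hc : 0 ≤ c) (h : x ≤ y + c) :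
    eexp (-s * y) ≤ eexp (S * c) * eexp (-s * x) := by
  rw [← eexp_add]
  exact eexp_le (by nlinarith)

/-- The algebra behind the second moment method. -/
theorem le_of_second_moment {φ ψ M Q A a a' f c N : ℝ≥0∞} (ha : a' * a = 1) (hf : f ≠ ∞)
    (hc : c ≠ ∞) (ha' : a' ≠ ∞) (hN : N ≠ ∞) (hψ : ψ ≠ ∞) (hM : M ≠ ∞)
    (h1 : φ * φ ≤ c * a * M) (h2 : A ≤ f * (a' * a') * (φ * ψ * φ)) (h3 : Q ≤ 2 * A + N * M)
    (h4 : ∀ x : ℝ≥0∞, x ≠ 0 → x ≠ ∞ → M ≤ x * ψ + x⁻¹ * Q) :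
    φ * φ ≤ 8 * f * c * c * (ψ * ψ) + 4 * c * (N + 1) * a * ψ := by
  have hA : A ≤ f * c * a' * ψ * M := by
    calc A ≤ f * (a' * a') * (φ * ψ * φ) := h2
      _ = f * (a' * a') * ψ * (φ * φ) := by ring
      _ ≤ f * (a' * a') * ψ * (c * a * M) := by gcongr
      _ = f * c * a' * ψ * M * (a' * a) := by ring
      _ = f * c * a' * ψ * M := by rw [ha, mul_one]
  set b : ℝ≥0∞ := 2 * (f * c * a' * ψ) + N + 1
  have hb : b ≠ ∞ := by
    simp only [b]
    finiteness
  have hb0 : b ≠ 0 := by simp [b]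
  have hQ : Q ≤ b * M := by
    calc Q ≤ 2 * (f * c * a' * ψ * M) + N * M := h3.trans (by gcongr)
      _ ≤ 2 * (f * c * a' * ψ * M) + N * M + M := le_self_add
      _ = b * M := by simp only [b]; ring
  have hM4 : M ≤ 4 * b * ψ := by
    have h5 := h4 (2 * b) (by simp [hb0]) (by finiteness)
    have h6 : (2 * b)⁻¹ * Q ≤ M / 2 := by
      calc (2 * b)⁻¹ * Q ≤ (2 * b)⁻¹ * (b * M) := by gcongr
        _ = 2⁻¹ * (b⁻¹ * b) * M := by
          rw [ENNReal.mul_inv (by simp) (by simp)]; ring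
        _ = M / 2 := by
          rw [ENNReal.inv_mul_cancel hb0 hb, mul_one, mul_comm, ENNReal.div_eq_inv_mul, mul_comm]
    have h7 : M / 2 + M / 2 ≤ 2 * b * ψ + M / 2 := by
      rw [ENNReal.add_halves]
      exact h5.trans (by gcongr)
    have h8 := (ENNReal.add_le_add_iff_right (ENNReal.div_ne_top hM (by simp))).1 h7
    calc M = M / 2 + M / 2 := (ENNReal.add_halves M).symm
      _ ≤ 2 * b * ψ + 2 * b * ψ := by gcongr
      _ = _ := by ring
  calc φ * φ ≤ c * a * (4 * b * ψ) := h1.trans (by gcongr)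
    _ = 8 * f * c * c * (ψ * ψ) * (a' * a) + 4 * c * (N + 1) * a * ψ := by
        simp only [b]; ring
    _ = _ := by rw [ha, mul_one]

end Sums

section Counting

open scoped ENNReal

variable {G : Type*} [Group G] {H : Subgroup G} {l : G → ℝ}

/-- The finite ball of radius `R`. -/
def IsProperLength.ball (hl : IsProperLength l) (R : ℝ) : Finset G := (hl.finite_le R).toFinset

theorem IsProperLength.mem_ball {hl : IsProperLength l} {R : ℝ} {g : G} :
    g ∈ hl.ball R ↔ l g ≤ R := by simp [IsProperLength.ball]

theorem IsProperLength.le_add (hl : IsProperLength l) (g h : G) : l h ≤ l g + l (g⁻¹ * h) := by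
  simpa using hl.map_mul_le g (g⁻¹ * h)

namespace Separators

/-- The concatenation of two elements, with a separator in between. -/
def join (E : Separators H l) (g k : G) : G := g * E.sep g k * k

variable (E : Separators H l)

theorem K_nonneg (hl : IsProperLength l) : 0 ≤ E.K := (hl.nonneg _).trans
    (E.le_of_mem _ (E.sep_mem 1 1))

theorem join_le (hl : IsProperLength l) (g k : G) : l (E.join g k) ≤ l g + l k + E.K := by
  have h1 := hl.map_mul_le (g * E.sep g k) k
  have h2 := hl.map_mul_le g (E.sep g k)
  have h3 := E.le_of_mem _ (E.sep_mem g k)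
  rw [join]
  linarith

theorem le_inv_mul_join (hl : IsProperLength l) (g k : G) : l k ≤ l (g⁻¹ * E.join g k) + E.K := by
  have h1 := hl.map_mul_le (E.sep g k)⁻¹ (E.sep g k * k)
  have h2 := E.le_of_mem _ (E.sep_mem g k)
  rw [hl.map_inv, inv_mul_cancel_left] at h1
  rw [join, mul_assoc, inv_mul_cancel_left]
  linarith

theorem add_le_join (hl : IsProperLength l) (g k : G) : l g + l k ≤ l (E.join g k) + 2 * E.K := by
  have h1 := E.add_le_of_mem_near _ g (E.mem_near g k) g (E.mem_near g k) 0 le_rfl (by simp)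
  have h2 := E.le_inv_mul_join hl g k
  have h3 := hl.nonneg (g⁻¹ * g)
  rw [join] at *
  linarith

theorem dist_le_of_mem_near (hl : IsProperLength l) {w u v : G} {t : ℝ} (hu : u ∈ E.near w)
    (hv : v ∈ E.near w) (ht : 0 ≤ t) (huv : l u ≤ l v + t) (hvu : l v ≤ l u + t) :
    l (u⁻¹ * v) ≤ E.K + 3 * t := by
  have h1 := E.add_le_of_mem_near w u hu v hv t ht huv
  have h2 := hl.le_add v w
  linarith

theorem join_mem (hnorm : H.Normal) {g k : G} (h : g * k ∈ H) : E.join g k ∈ H := by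
  have h1 := H.mul_mem (hnorm.conj_mem _ (E.mem_of_mem _ (E.sep_mem g k)) g) h
  rwa [show g * E.sep g k * g⁻¹ * (g * k) = E.join g k by rw [join]; group] at h1

theorem eq_of_join_eq {g k k' : G} (h : E.join g k = E.join g k') (h' : E.sep g k = E.sep g k') :
    k = k' := by
  rw [join, join, h'] at h
  exact mul_left_cancel h

/-- Summing over pairs that are aligned in a uniform way costs no more than summing over `H`. -/
theorem tsum_pairs_le (hl : IsProperLength l) (hnorm : H.Normal) {s S t : ℝ} (hs : 0 ≤ s)
    (hS : s ≤ S) (ht : 0 ≤ t)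
    (P : Set (G × G)) (hP : ∀ p ∈ P, p.1 * p.2 ∈ H)
    (hclose : ∀ p ∈ P, ∀ p' ∈ P, E.join p.1 p.2 = E.join p'.1 p'.2 → l p.1 ≤ l p'.1 + t) :
    ∑' p : P, eexp (-s * l p.1.1) * eexp (-s * l p.1.2) ≤
      (hl.ball (E.K + 3 * t) ×ˢ E.F).card * eexp (S * E.K) * ∑' h : H, eexp (-s * l h) := by
  refine tsum_le_of_fiber (fun p : P => (⟨E.join p.1.1 p.1.2, E.join_mem hnorm (hP _ p.2)⟩ : H))
    (fun p p' => (p.1.1⁻¹ * p'.1.1, E.sep p'.1.1 p'.1.2)) _ (fun p => ?_) (fun p p' h => ?_)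
    fun p p' p'' h h' hq => ?_
  · rw [← eexp_add, ← mul_add]
    exact eexp_le_mul hs hS (E.K_nonneg hl) (E.join_le hl _ _)
  · have h1 : E.join p.1.1 p.1.2 = E.join p'.1.1 p'.1.2 := congrArg Subtype.val h
    refine Finset.mem_product.2 ⟨hl.mem_ball.2 ?_, E.sep_mem _ _⟩
    refine E.dist_le_of_mem_near hl (E.mem_near p.1.1 p.1.2) ?_ ht (hclose _ p.2 _ p'.2 h1)
      (hclose _ p'.2 _ p.2 h1.symm)
    rw [join, join] at h1
    rw [h1]
    exact E.mem_near _ _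
  · have h1 : E.join p'.1.1 p'.1.2 = E.join p''.1.1 p''.1.2 :=
      (congrArg Subtype.val h).symm.trans (congrArg Subtype.val h')
    obtain ⟨hq1, hq2⟩ := Prod.mk.inj hq
    have h2 : p'.1.1 = p''.1.1 := mul_left_cancel hq1
    refine Subtype.ext (Prod.ext h2 ?_)
    rw [h2] at h1 hq2
    exact E.eq_of_join_eq h1 hq2

/-- The orbital series of `G` at the exponent `2s` is controlled by that of `H` at `s`. -/
theorem tsum_two_mul_le (hl : IsProperLength l) (hnorm : H.Normal) {s S : ℝ} (hs : 0 ≤ s)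
    (hS : s ≤ S) :
    ∑' g, eexp (-(2 * s) * l g) ≤
      (hl.ball (E.K + 3 * (2 * E.K)) ×ˢ E.F).card * eexp (S * E.K) *
        ∑' h : H, eexp (-s * l h) := by
  have hK := E.K_nonneg hl
  refine le_trans ?_ (E.tsum_pairs_le hl hnorm hs hS (t := 2 * E.K) (by positivity)
    (Set.range fun g : G => (g, g⁻¹)) ?_ ?_)
  · refine le_trans (le_of_eq (tsum_congr fun g => ?_))
      (ENNReal.tsum_comp_le_tsum_of_injective
        (f := fun g : G => (⟨(g, g⁻¹), g, rfl⟩ : Set.range fun g : G => (g, g⁻¹)))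
        (fun g g' h => (Prod.mk.inj (congrArg Subtype.val h)).1) _)
    simp only
    rw [hl.map_inv, ← eexp_add]
    ring_nf
  · rintro _ ⟨g, rfl⟩
    simp
  · rintro _ ⟨g, rfl⟩ _ ⟨g', rfl⟩ h
    have h1 := E.add_le_join hl g g⁻¹
    have h2 := E.join_le hl g' g'⁻¹
    simp only at h
    rw [h] at h1
    rw [hl.map_inv] at h1 h2
    linarith

/-- Summing over an annulus and its `H`-partners. -/
theorem tsum_annulus_le (hl : IsProperLength l) (hnorm : H.Normal) {s S : ℝ} (hs : 0 ≤ s)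
    (hS : s ≤ S) (n : ℕ) :
    ∑' g : {g : G | ⌊l g⌋₊ = n}, eexp (-s * l g) * ∑' k : {k | (g : G) * k ∈ H}, eexp (-s * l k) ≤
      (hl.ball (E.K + 3 * 1) ×ˢ E.F).card * eexp (S * E.K) * ∑' h : H, eexp (-s * l h) := by
  refine le_trans (le_of_eq ?_) (E.tsum_pairs_le hl hnorm hs hS zero_le_one
    {p | ⌊l p.1⌋₊ = n ∧ p.1 * p.2 ∈ H} (fun p hp => hp.2) ?_)
  · simp only [← ENNReal.tsum_mul_left]
    rw [tsum_subtype {g : G | ⌊l g⌋₊ = n} fun g => ∑' k : {k | (g : G) * k ∈ H},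
        eexp (-s * l g) * eexp (-s * l k),
      tsum_subtype {p : G × G | ⌊l p.1⌋₊ = n ∧ p.1 * p.2 ∈ H} fun p =>
        eexp (-s * l p.1) * eexp (-s * l p.2),
      ENNReal.tsum_prod (f := fun g k => {p : G × G | ⌊l p.1⌋₊ = n ∧ p.1 * p.2 ∈ H}.indicator
        (fun p => eexp (-s * l p.1) * eexp (-s * l p.2)) (g, k))]
    refine tsum_congr fun g => ?_
    by_cases hg : ⌊l g⌋₊ = n
    · rw [Set.indicator_of_mem (by exact hg), tsum_subtype {k | (g : G) * k ∈ H} fun k =>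
        eexp (-s * l g) * eexp (-s * l k)]
      refine tsum_congr fun k => ?_
      by_cases hk : g * k ∈ H
      · rw [Set.indicator_of_mem (by exact hk), Set.indicator_of_mem (by exact ⟨hg, hk⟩)]
      · rw [Set.indicator_of_notMem (by exact hk),
          Set.indicator_of_notMem (by exact fun h => hk h.2)]
    · simp [Set.indicator, hg]
  · rintro p ⟨hp, -⟩ p' ⟨hp', -⟩ -
    have h1 := Nat.lt_floor_add_one (l p.1)
    have h2 := Nat.floor_le (hl.nonneg p'.1)
    rw [hp] at h1
    rw [hp'] at h2
    linarith

end Separators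

end Counting

section SecondMoment

open scoped ENNReal

variable {G : Type*} [Group G] {H : Subgroup G} {l : G → ℝ}

namespace Separators

variable (E : Separators H l)

theorem add_le_of_far (hl : IsProperLength l) {g h k h' k' : G}
    (he : E.join (E.join h g) k = E.join (E.join h' g) k') (hle : l (E.join h g) ≤ l h') :
    l h + 2 * l g + l ((E.join h g)⁻¹ * h') + l k' ≤ l (E.join (E.join h g) k) + 7 * E.K := by
  have h1 : E.join h g ∈ E.near (E.join (E.join h g) k) := E.mem_near _ _
  have h2 : h' ∈ E.near (E.join (E.join h g) k) := by
    rw [he]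
    exact E.mem_near_mul _ _ _
  have h3 := E.add_le_of_mem_near _ _ h1 _ h2 0 le_rfl (by linarith)
  have h4 := E.add_le_join hl (E.join h' g) k'
  have h5 := E.add_le_join hl h' g
  have h6 := E.add_le_join hl h g
  have h7 := hl.le_add h' (E.join (E.join h g) k)
  rw [← he] at h4
  linarith

theorem dist_le_of_not_far (hl : IsProperLength l) {g h k h' k' : G}
    (he : E.join (E.join h g) k = E.join (E.join h' g) k') (h1 : l h' ≤ l (E.join h g))
    (h2 : l h ≤ l (E.join h' g)) : l (h⁻¹ * h') ≤ E.K + 3 * (l g + E.K) := by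
  have h3 : h ∈ E.near (E.join (E.join h g) k) := E.mem_near_mul _ _ _
  have h4 : h' ∈ E.near (E.join (E.join h g) k) := by
    rw [he]
    exact E.mem_near_mul _ _ _
  have h5 := E.join_le hl h g
  have h6 := E.join_le hl h' g
  exact E.dist_le_of_mem_near hl h3 h4 (add_nonneg (hl.nonneg _) (E.K_nonneg hl))
    (by linarith) (by linarith)

/-- The map sending a pair of elements of `H` to the inverse of their concatenation with `g` in
between. -/
def bridge (hnorm : H.Normal) (g : G) (t : H × H) : {k | g * k ∈ H} :=
  ⟨(E.join (E.join t.1 g) t.2)⁻¹, by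
    have h1 := hnorm.conj_mem _ (H.inv_mem (H.mul_mem
      (E.mem_of_mem _ (E.sep_mem (E.join t.1 g) t.2)) t.2.2)) g
    have h2 := H.inv_mem (H.mul_mem t.1.2 (E.mem_of_mem _ (E.sep_mem t.1 g)))
    have h3 := H.mul_mem h1 h2
    have h4 : g * (E.join (E.join t.1 g) t.2)⁻¹ ∈ H := by
      convert h3 using 1
      change g * (E.join t.1 g * E.sep (E.join t.1 g) t.2 * t.2)⁻¹ = _
      generalize E.sep (E.join t.1 g) t.2 = a
      rw [join]
      group
    exact h4⟩

theorem bridge_eq_iff {hnorm : H.Normal} {g : G} {t t' : H × H} :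
    E.bridge hnorm g t = E.bridge hnorm g t' ↔
      E.join (E.join t.1 g) t.2 = E.join (E.join t'.1 g) t'.2 := by
  rw [Subtype.ext_iff]
  exact inv_inj

theorem length_bridge (hl : IsProperLength l) (hnorm : H.Normal) (g : G) (t : H × H) :
    l (E.bridge hnorm g t) = l (E.join (E.join t.1 g) t.2) := hl.map_inv _

theorem tsum_far_le (hl : IsProperLength l) (hnorm : H.Normal) {s S : ℝ} (hs : 0 ≤ s) (hS : s ≤ S)
    (g : G) :
    ∑' p : {p : (H × H) × (H × H) | E.bridge hnorm g p.1 = E.bridge hnorm g p.2 ∧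
      l (E.join p.1.1 g) ≤ l p.2.1}, eexp (-s * l (E.bridge hnorm g p.1.1)) ≤
    E.F.card * eexp (S * (7 * E.K)) * (eexp (-s * l g) * eexp (-s * l g)) *
      ((∑' h : H, eexp (-s * l h)) * (∑' k : {k | g * k ∈ H}, eexp (-s * l k)) *
        ∑' h : H, eexp (-s * l h)) := by
  rw [tsum_mul_tsum, tsum_mul_tsum, mul_assoc (E.F.card : ℝ≥0∞)]
  have hK := E.K_nonneg hl
  have hmem : ∀ h h' : H, g * ((E.join h g)⁻¹ * h') ∈ H := fun h h' => by
    have h1 := H.mul_mem (H.inv_mem (H.mul_mem h.2 (E.mem_of_mem _ (E.sep_mem h g)))) h'.2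
    convert h1 using 1
    rw [join]
    group
  refine tsum_le_of_fiber (fun p => ((p.1.1.1, ⟨(E.join p.1.1.1 g)⁻¹ * p.1.2.1, hmem _ _⟩),
    p.1.2.2)) (fun _ p => E.sep (E.join p.1.1.1 g) p.1.1.2) E.F (fun p => ?_) (fun _ _ _ => E.sep_mem _ _) ?_
  · simp only [← eexp_add, ← mul_add]
    rw [add_assoc, ← mul_add, eexp_add]
    refine eexp_le_mul hs hS (by positivity) ?_
    have := E.add_le_of_far hl (E.bridge_eq_iff.1 p.2.1) p.2.2
    rw [E.length_bridge hl]
    linarith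
  · intro _ p p' hp hp' hq
    have hpp := hp.symm.trans hp'
    have h1 : p.1.1.1 = p'.1.1.1 := congrArg (fun x => x.1.1) hpp
    have h2 : (E.join p.1.1.1 g)⁻¹ * p.1.2.1 = (E.join p'.1.1.1 g)⁻¹ * p'.1.2.1 :=
      congrArg (fun x => (x.1.2 : G)) hpp
    have h3 : p.1.2.2 = p'.1.2.2 := congrArg (fun x => x.2) hpp
    rw [h1] at h2
    have h4 : p.1.2 = p'.1.2 := Prod.ext (Subtype.ext (mul_left_cancel h2)) h3
    have h5 := E.bridge_eq_iff.1 (p.2.1.trans ((congrArg _ h4).trans p'.2.1.symm))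
    rw [h1] at h5 hq
    exact Subtype.ext (Prod.ext (Prod.ext h1 (Subtype.ext (E.eq_of_join_eq h5 hq))) h4)

theorem tsum_near_le (hl : IsProperLength l) (hnorm : H.Normal) {s : ℝ} (g : G) :
    ∑' p : {p : (H × H) × (H × H) | E.bridge hnorm g p.1 = E.bridge hnorm g p.2 ∧
      l p.2.1 ≤ l (E.join p.1.1 g) ∧ l p.1.1 ≤ l (E.join p.2.1 g)},
        eexp (-s * l (E.bridge hnorm g p.1.1)) ≤
    (hl.ball (E.K + 3 * (l g + E.K)) ×ˢ E.F).card *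
      ∑' t, eexp (-s * l (E.bridge hnorm g t)) := by
  rw [← mul_one ((hl.ball (E.K + 3 * (l g + E.K)) ×ˢ E.F).card : ℝ≥0∞)]
  refine tsum_le_of_fiber (v := fun t => eexp (-s * l (E.bridge hnorm g t))) (fun p => p.1.1)
    (fun _ p => ((p.1.1.1⁻¹ * p.1.2.1 : G), E.sep (E.join p.1.2.1 g) p.1.2.2)) _
    (fun p => by rw [one_mul]) (fun _ p _ => ?_) ?_
  · exact Finset.mem_product.2 ⟨hl.mem_ball.2
      (E.dist_le_of_not_far hl (E.bridge_eq_iff.1 p.2.1) p.2.2.1 p.2.2.2), E.sep_mem _ _⟩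
  · intro p₀ p p' hp hp' hq
    have h1 : p.1.1 = p'.1.1 := hp.symm.trans hp'
    have h2 : p.1.2.1 = p'.1.2.1 := by
      have h := (Prod.mk.inj hq).1
      rw [h1] at h
      exact Subtype.ext (mul_left_cancel h)
    have h3 := E.bridge_eq_iff.1 (p.2.1.symm.trans ((congrArg _ h1).trans p'.2.1))
    have h4 := (Prod.mk.inj hq).2
    rw [h2] at h3 h4
    exact Subtype.ext (Prod.ext h1 (Prod.ext h2 (Subtype.ext (E.eq_of_join_eq h3 h4))))

/-- The second moment estimate, comparing the orbital series of `H` with that of its cosets. -/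
theorem second_moment (E : Separators H l) (hl : IsProperLength l) (hnorm : H.Normal) (S : ℝ) :
    ∃ c₁ : ℝ≥0∞, c₁ ≠ ∞ ∧ ∀ g : G, ∃ c₂ : ℝ≥0∞, c₂ ≠ ∞ ∧ ∀ s, 0 ≤ s → s ≤ S →
      ∑' h : H, eexp (-s * l h) ≠ ∞ →
      (∑' h : H, eexp (-s * l h)) * ∑' h : H, eexp (-s * l h) ≤
        c₁ * ((∑' k : {k | g * k ∈ H}, eexp (-s * l k)) * ∑' k : {k | g * k ∈ H}, eexp (-s * l k)) +
        c₂ * ∑' k : {k | g * k ∈ H}, eexp (-s * l k) := by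
  have hK := E.K_nonneg hl
  set f : ℝ≥0∞ := E.F.card * eexp (S * (7 * E.K)) with hf
  set c : ℝ≥0∞ := eexp (S * (2 * E.K)) with hc
  have hf' : f ≠ ∞ := ENNReal.mul_ne_top (by simp) (eexp_ne_top _)
  have hc' : c ≠ ∞ := eexp_ne_top _
  refine ⟨8 * f * c * c, by finiteness, fun g => ?_⟩
  set N : ℝ≥0∞ := (((hl.ball (E.K + 3 * (l g + E.K)) ×ˢ E.F).card : ℕ) : ℝ≥0∞) with hN
  have hN' : N ≠ ∞ := ENNReal.natCast_ne_top _
  have he' := eexp_ne_top (S * l g)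
  refine ⟨4 * c * (N + 1) * eexp (S * l g), by finiteness, fun s hs hsS hφ => ?_⟩
  set φ := ∑' h : H, eexp (-s * l h)
  set ψ := ∑' k : {k | g * k ∈ H}, eexp (-s * l k)
  have hψ : ψ ≠ ∞ := by
    have h1 : ψ ≤ eexp (S * l g) * φ := by
      rw [← ENNReal.tsum_mul_left]
      refine le_trans (ENNReal.tsum_le_tsum fun k => ?_)
        (ENNReal.tsum_comp_le_tsum_of_injective (f := fun k : {k | g * k ∈ H} => (⟨g * k, k.2⟩ : H))
        (fun k k' h => Subtype.ext (mul_left_cancel (congrArg Subtype.val h))) _)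
      exact eexp_le_mul hs hsS (hl.nonneg g) (by linarith [hl.map_mul_le g k])
    exact ne_top_of_le_ne_top (ENNReal.mul_ne_top he' hφ) h1
  set W := E.bridge hnorm g
  set M := ∑' t, eexp (-s * l (W t))
  have hM : M ≠ ∞ := by
    have h1 : M ≤ eexp (S * (4 * E.K)) * (φ * φ) := by
      rw [tsum_mul_tsum, ← ENNReal.tsum_mul_left]
      refine ENNReal.tsum_le_tsum fun t => ?_
      rw [← eexp_add, ← mul_add]
      refine eexp_le_mul hs hsS (by positivity) ?_
      have h1 := E.add_le_join hl (E.join t.1 g) t.2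
      have h2 := E.add_le_join hl t.1 g
      have h3 := hl.nonneg g
      rw [E.length_bridge hl]
      linarith
    exact ne_top_of_le_ne_top (ENNReal.mul_ne_top (eexp_ne_top _) (ENNReal.mul_ne_top hφ hφ)) h1
  have h1 : φ * φ ≤ c * eexp (s * l g) * M := by
    rw [tsum_mul_tsum, ← ENNReal.tsum_mul_left]
    refine ENNReal.tsum_le_tsum fun t => ?_
    rw [← eexp_add, ← mul_add, mul_assoc, ← eexp_add,
      show s * l g + -s * l (W t) = -s * (l (W t) - l g) by ring]
    refine eexp_le_mul hs hsS (by positivity) ?_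
    have h1 := E.join_le hl (E.join t.1 g) t.2
    have h2 := E.join_le hl t.1 g
    rw [E.length_bridge hl]
    linarith
  set A := ∑' p : {p : (H × H) × (H × H) | W p.1 = W p.2 ∧
      l (E.join p.1.1 g) ≤ l p.2.1}, eexp (-s * l (W p.1.1))
  set Q := ∑' p : {p : (H × H) × (H × H) | W p.1 = W p.2}, eexp (-s * l (W p.1.1))
  have h3 : Q ≤ 2 * A + N * M := by
    set U : Set ((H × H) × (H × H)) := {p | W p.1 = W p.2 ∧ l (E.join p.1.1 g) ≤ l p.2.1}
    set U' : Set ((H × H) × (H × H)) := {p | W p.1 = W p.2 ∧ l (E.join p.2.1 g) ≤ l p.1.1}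
    set V : Set ((H × H) × (H × H)) :=
      {p | W p.1 = W p.2 ∧ l p.2.1 ≤ l (E.join p.1.1 g) ∧ l p.1.1 ≤ l (E.join p.2.1 g)}
    have hU' : ∑' p : U', eexp (-s * l (W p.1.1)) ≤ A := by
      refine le_trans (le_of_eq (tsum_congr fun p => ?_))
        (ENNReal.tsum_comp_le_tsum_of_injective
        (f := fun p : U' => (⟨p.1.swap, p.2.1.symm, p.2.2⟩ : U))
        (fun p p' h => Subtype.ext (Prod.swap_injective (congrArg Subtype.val h))) _)
      simp only [Prod.fst_swap]
      rw [show W p.1.1 = W p.1.2 from p.2.1]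
    have hsub : {p : (H × H) × (H × H) | W p.1 = W p.2} ⊆ (U ∪ U') ∪ V := by
      intro p hp
      rcases le_or_gt (l (E.join p.1.1 g)) (l p.2.1) with h | h
      · exact Or.inl (Or.inl ⟨hp, h⟩)
      rcases le_or_gt (l (E.join p.2.1 g)) (l p.1.1) with h' | h'
      · exact Or.inl (Or.inr ⟨hp, h'⟩)
      · exact Or.inr ⟨hp, h.le, h'.le⟩
    set y := fun p : (H × H) × (H × H) => eexp (-s * l (W p.1))
    calc Q ≤ ∑' p : ((U ∪ U') ∪ V : Set _), y p := ENNReal.tsum_mono_subtype y hsub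
      _ ≤ ∑' p : U, y p + ∑' p : U', y p + ∑' p : V, y p :=
          (ENNReal.tsum_union_le y _ _).trans (add_le_add (ENNReal.tsum_union_le y _ _) le_rfl)
      _ ≤ (A + A) + N * M := add_le_add (add_le_add le_rfl hU') (E.tsum_near_le hl hnorm g)
      _ = _ := by rw [two_mul]
  have h0 : eexp (-s * l g) * eexp (s * l g) = 1 := by
    rw [← eexp_add]
    simp [eexp]
  refine (le_of_second_moment h0 hf' hc' (eexp_ne_top _) hN' hψ hM h1
    (E.tsum_far_le hl hnorm hs hsS g) h3
    fun x hx hx' => tsum_comp_le_collision W (fun k => eexp (-s * l k)) hx hx').trans ?_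
  gcongr
  exact eexp_le (mul_le_mul_of_nonneg_right hsS (hl.nonneg g))

end Separators

end SecondMoment

section Limit

open scoped ENNReal

variable {G : Type*} [Group G] {H : Subgroup G} {l : G → ℝ}

theorem continuous_eexp : Continuous eexp := ENNReal.continuous_ofReal.comp Real.continuous_exp

namespace Separators


theorem eventually_lt_tsum (E : Separators H l) (hl : IsProperLength l) (hnorm : H.Normal)
    {s₀ : ℝ} (hs₀ : 0 ≤ s₀)
    (hG : ∑' g, eexp (-(2 * s₀) * l g) = ∞) {R : ℝ≥0∞} (hR : R ≠ ∞) :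
    ∀ᶠ s in 𝓝[>] s₀, R < ∑' h : H, eexp (-s * l h) := by
  set D : ℝ≥0∞ := (hl.ball (E.K + 3 * (2 * E.K)) ×ˢ E.F).card * eexp ((s₀ + 1) * E.K)
  have hD : D ≠ ∞ := ENNReal.mul_ne_top (ENNReal.natCast_ne_top _) (eexp_ne_top _)
  rw [ENNReal.tsum_eq_iSup_sum] at hG
  obtain ⟨B, hB⟩ := lt_iSup_iff.1 ((ENNReal.mul_ne_top hD hR).lt_top.trans_eq hG.symm)
  have hc : Continuous fun s : ℝ => ∑ g ∈ B, eexp (-(2 * s) * l g) :=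
    continuous_finsetSum _ fun g _ => continuous_eexp.comp (by fun_prop)
  filter_upwards [nhdsWithin_le_nhds (hc.continuousAt.eventually (lt_mem_nhds hB)),
    self_mem_nhdsWithin, nhdsWithin_le_nhds (eventually_le_nhds (lt_add_one s₀))] with s h1 h2 h3
  have h4 := (ENNReal.sum_le_tsum B).trans
    (E.tsum_two_mul_le hl hnorm (hs₀.trans (le_of_lt h2)) h3)
  exact lt_of_mul_lt_mul_left' (h1.trans_le h4)

/-- Near the critical exponent, the orbital series of `H` is uniformly controlled by those of its
cosets. -/
theorem exists_eventually_tsum_le (E : Separators H l) (hl : IsProperLength l) (hnorm : H.Normal)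
    {s₀ : ℝ}
    (hs₀ : 0 ≤ s₀) (hG : ∑' g, eexp (-(2 * s₀) * l g) = ∞)
    (hH : ∀ s > s₀, ∑' h : H, eexp (-s * l h) ≠ ∞) :
    ∃ c : ℝ≥0∞, c ≠ ∞ ∧ ∀ g : G, ∀ᶠ s in 𝓝[>] s₀,
      ∑' h : H, eexp (-s * l h) ≤ c * ∑' k : {k | g * k ∈ H}, eexp (-s * l k) := by
  obtain ⟨c₁, hc₁, h⟩ := E.second_moment hl hnorm (s₀ + 1)
  refine ⟨c₁ + 1, by finiteness, fun g => ?_⟩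
  obtain ⟨c₂, hc₂, h⟩ := h g
  filter_upwards [E.eventually_lt_tsum hl hnorm hs₀ hG
      (R := c₁ * (c₂ * c₂) + c₂ * c₂ + 1) (by finiteness),
    self_mem_nhdsWithin, nhdsWithin_le_nhds (eventually_le_nhds (lt_add_one s₀))] with s h1 h2 h3
  have h4 := h s (hs₀.trans (le_of_lt h2)) h3 (hH s h2)
  generalize ∑' h : H, eexp (-s * l h) = φ at *
  generalize ∑' k : {k | g * k ∈ H}, eexp (-s * l k) = ψ at *
  have hφ : 1 ≤ φ := le_add_self.trans h1.le
  rcases le_total c₂ ψ with h5 | h5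
  · by_contra! h6
    refine absurd (h4.trans ?_) (not_le.2 (ENNReal.mul_lt_mul h6 h6))
    calc c₁ * (ψ * ψ) + c₂ * ψ ≤ c₁ * (ψ * ψ) + ψ * ψ := by gcongr
      _ = (c₁ + 1) * 1 * (ψ * ψ) := by ring
      _ ≤ (c₁ + 1) * (c₁ + 1) * (ψ * ψ) := by gcongr; exact le_add_self
      _ = _ := by ring
  · refine absurd (h4.trans ?_) (not_le.2 (h1.trans_le (le_mul_of_one_le_left' hφ)))
    calc c₁ * (ψ * ψ) + c₂ * ψ ≤ c₁ * (c₂ * c₂) + c₂ * c₂ := by gcongr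
      _ ≤ _ := le_self_add

/-- If `G` diverges at twice the critical exponent of `H`, then the annuli of `G` grow slowly. -/
theorem exists_tsum_annulus_le (E : Separators H l) (hl : IsProperLength l) (hnorm : H.Normal)
    {s₀ : ℝ}
    (hs₀ : 0 ≤ s₀) (hG : ∑' g, eexp (-(2 * s₀) * l g) = ∞)
    (hH : ∀ s > s₀, ∑' h : H, eexp (-s * l h) ≠ ∞) :
    ∃ C : ℝ≥0∞, C ≠ ∞ ∧ ∀ n : ℕ, ∑' g : {g : G | ⌊l g⌋₊ = n}, eexp (-s₀ * l g) ≤ C := by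
  obtain ⟨c, hc, h⟩ := E.exists_eventually_tsum_le hl hnorm hs₀ hG hH
  set N : ℝ≥0∞ := (hl.ball (E.K + 3 * 1) ×ˢ E.F).card * eexp ((s₀ + 1) * E.K)
  have hN : N ≠ ∞ := ENNReal.mul_ne_top (ENNReal.natCast_ne_top _) (eexp_ne_top _)
  refine ⟨c * N, ENNReal.mul_ne_top hc hN, fun n => ?_⟩
  rw [ENNReal.tsum_eq_iSup_sum]
  refine iSup_le fun B => ?_
  have hcont : Continuous fun s : ℝ => ∑ g ∈ B, eexp (-s * l g) :=
    continuous_finsetSum _ fun g _ => continuous_eexp.comp (by fun_prop)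
  refine le_of_tendsto (hcont.continuousAt.tendsto.mono_left (nhdsWithin_le_nhds (s := Ioi s₀))) ?_
  filter_upwards [E.eventually_lt_tsum hl hnorm hs₀ hG (R := 0) (by finiteness),
    (Finset.eventually_all B).2 fun g _ => h g,
    self_mem_nhdsWithin, nhdsWithin_le_nhds (eventually_le_nhds (lt_add_one s₀))] with s h1 h2 h3 h4
  rw [← ENNReal.mul_le_mul_iff_left h1.ne' (hH s h3), Finset.sum_mul]
  calc ∑ g ∈ B, eexp (-s * l g) * ∑' h : H, eexp (-s * l h)
      ≤ ∑ g ∈ B, c * (eexp (-s * l g) * ∑' k : {k | (g : G) * k ∈ H}, eexp (-s * l k)) :=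
        Finset.sum_le_sum fun g hg => by
          rw [mul_left_comm]
          exact mul_le_mul_right (h2 g hg) _
    _ ≤ c * (N * ∑' h : H, eexp (-s * l h)) := by
        rw [← Finset.mul_sum]
        gcongr
        exact (ENNReal.sum_le_tsum B).trans
          (E.tsum_annulus_le hl hnorm (hs₀.trans (le_of_lt h3)) h4 n)
    _ = _ := (mul_assoc c N _).symm

end Separators

end Limit

section Growth

open scoped ENNReal

theorem tsum_eexp_nat_ne_top {t : ℝ} (ht : 0 < t) : ∑' n : ℕ, eexp (-t * n) ≠ ∞ := by
  have h1 : ∀ n : ℕ, eexp (-t * n) = eexp (-t) ^ n := fun n => by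
    rw [eexp, eexp, ← ENNReal.ofReal_pow (Real.exp_pos _).le, ← Real.exp_nat_mul, mul_comm]
  simp only [h1]
  rw [ENNReal.tsum_geometric, Ne, ENNReal.inv_eq_top, tsub_eq_zero_iff_le, not_le, eexp,
    ENNReal.ofReal_lt_one]
  exact Real.exp_lt_one_iff.2 (by linarith)

variable {α : Type*} {l : α → ℝ}

theorem tsum_le_tsum_annuli {u : α → ℝ≥0∞} {v : ℕ → ℝ≥0∞}
    (h : ∀ n : ℕ, ∑' a : {a | ⌊l a⌋₊ = n}, u a ≤ v n) : ∑' a, u a ≤ ∑' n, v n := by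
  rw [← ENNReal.tsum_fiberwise u fun a => ⌊l a⌋₊]
  exact ENNReal.tsum_le_tsum h

theorem tsum_eexp_ne_top (hl : ∀ a, 0 ≤ l a) {D : ℝ≥0∞} (hD : D ≠ ∞) {s' s : ℝ} (hs : 0 ≤ s)
    (hs' : s' < s) (hcount : ∀ n : ℕ, ({a | l a ≤ n}.encard : ℝ≥0∞) ≤ D * eexp (s' * n)) :
    ∑' a, eexp (-s * l a) ≠ ∞ := by
  refine ne_top_of_le_ne_top (ENNReal.mul_ne_top (ENNReal.mul_ne_top hD (eexp_ne_top s'))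
    (tsum_eexp_nat_ne_top (sub_pos.2 hs'))) ?_
  rw [← ENNReal.tsum_mul_left]
  refine tsum_le_tsum_annuli (l := l) fun n => ?_
  calc ∑' a : {a | ⌊l a⌋₊ = n}, eexp (-s * l a)
      ≤ ∑' _ : {a | ⌊l a⌋₊ = n}, eexp (-s * n) := ENNReal.tsum_le_tsum fun a => by
        have h1 := Nat.floor_le (hl a)
        rw [show ⌊l a⌋₊ = n from a.2] at h1
        exact eexp_le (by nlinarith)
    _ = ({a | ⌊l a⌋₊ = n}.encard : ℝ≥0∞) * eexp (-s * n) := ENNReal.tsum_set_const _ _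
    _ ≤ D * eexp (s' * (n + 1 : ℕ)) * eexp (-s * n) := by
        gcongr
        refine le_trans (ENat.toENNReal_le.2 (Set.encard_le_encard fun a ha => ?_))
          (hcount (n + 1))
        have h1 := Nat.lt_floor_add_one (l a)
        rw [show ⌊l a⌋₊ = n from ha] at h1
        exact_mod_cast h1.le
    _ = _ := by
        rw [mul_assoc, mul_assoc, ← eexp_add, ← eexp_add]
        push_cast
        ring_nf

theorem exists_lt_encard_annulus {G : Type*} [Group G] {l : G → ℝ} (hl : IsProperLength l)
    {f h : G} (hf : ∀ n : ℤ, n ≠ 0 → f ^ n ≠ 1) (hh : h ∉ commensurating f) (m : ℕ) :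
    ∃ n : ℕ, (m : ℕ∞) < {g : G | ⌊l g⌋₊ = n}.encard := by
  by_contra! hA
  obtain ⟨a, ha⟩ := exists_nat_ge (2 * l f)
  obtain ⟨b, hb⟩ := exists_nat_ge (l h)
  have hpow : ∀ i : ℕ, l (f ^ i) ≤ (i + 1) * a := fun i => by
    induction i with
    | zero =>
      have h1 := hl.map_mul_le f f⁻¹
      rw [hl.map_inv, mul_inv_cancel] at h1
      rw [pow_zero, Nat.cast_zero]
      linarith
    | succ i ih =>
      rw [pow_succ]
      push_cast
      linarith [hl.map_mul_le (f ^ i) f, hl.nonneg f]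
  have hinj : ∀ i j i' j' : ℕ, f ^ i * h * f ^ j = f ^ i' * h * f ^ j' → i = i' ∧ j = j' := by
    intro i j i' j' he
    have h1 : h * f ^ ((j : ℤ) - j') * h⁻¹ = f ^ ((i' : ℤ) - i) := by
      rw [zpow_sub, zpow_sub, zpow_natCast, zpow_natCast, zpow_natCast, zpow_natCast]
      have h2 : f ^ i' = f ^ i * h * f ^ j * (f ^ j')⁻¹ * h⁻¹ := by rw [he]; group
      have h3 : f ^ i' * (f ^ i)⁻¹ = (f ^ i)⁻¹ * f ^ i' := by
        rw [← zpow_natCast, ← zpow_natCast, ← zpow_neg, ← zpow_add, ← zpow_add, add_comm]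
      rw [h3, h2]
      group
    by_cases hj : (j : ℤ) - j' = 0
    · rw [hj, zpow_zero, mul_one, mul_inv_cancel] at h1
      by_cases hi : (i' : ℤ) - i = 0
      · omega
      · exact absurd h1.symm (hf _ hi)
    · by_cases hi : (i' : ℤ) - i = 0
      · rw [hi, zpow_zero, mul_inv_eq_one, mul_eq_left] at h1
        exact absurd h1 (hf _ hj)
      · exact absurd ⟨_, _, hj, hi, h1⟩ hh
  set N : ℕ := m * (2 * a + b + 1) + 1
  have hcard := Finset.card_le_mul_card_image_of_maps_to
    (s := Finset.range N ×ˢ Finset.range N) (t := Finset.range (N * a + b + N * a + 1))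
    (f := fun p : ℕ × ℕ => ⌊l (f ^ p.1 * h * f ^ p.2)⌋₊) (fun p hp => ?_) m fun n _ => ?_
  · rw [Finset.card_product, Finset.card_range, Finset.card_range] at hcard
    have : N = m * (2 * a + b + 1) + 1 := rfl
    have : 1 ≤ N := by omega
    nlinarith [Nat.zero_le (m * (b + 1) * (N - 1)), mul_le_mul_right this (m * (b + 1))]
  · obtain ⟨h1, h2⟩ := Finset.mem_product.1 hp
    have h3 : ((p.1 : ℝ) + 1) ≤ N := by exact_mod_cast Finset.mem_range.1 h1
    have h4 : ((p.2 : ℝ) + 1) ≤ N := by exact_mod_cast Finset.mem_range.1 h2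
    have ha0 : (0 : ℝ) ≤ a := Nat.cast_nonneg a
    refine Finset.mem_range.2 (Nat.lt_succ_of_le (Nat.floor_le_of_le ?_))
    push_cast
    have h5 := hl.map_mul_le (f ^ p.1 * h) (f ^ p.2)
    have h6 := hl.map_mul_le (f ^ p.1) h
    linarith [hpow p.1, hpow p.2, mul_le_mul_of_nonneg_right h3 ha0,
      mul_le_mul_of_nonneg_right h4 ha0]
  · have h1 := (Set.encard_le_encard_of_injOn
      (s := (({p ∈ Finset.range N ×ˢ Finset.range N | ⌊l (f ^ p.1 * h * f ^ p.2)⌋₊ = n} :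
        Finset (ℕ × ℕ)) : Set (ℕ × ℕ)))
      (t := {g : G | ⌊l g⌋₊ = n}) (f := fun p => f ^ p.1 * h * f ^ p.2)
      (fun p hp => (Finset.mem_filter.1 hp).2)
      fun p _ p' _ he => Prod.ext (hinj _ _ _ _ he).1 (hinj _ _ _ _ he).2).trans (hA n)
    rw [Set.encard_coe_eq_coe_finsetCard] at h1
    exact_mod_cast h1

variable {G : Type*} [Group G] {H : Subgroup G} {l : G → ℝ}

/-- The orbital series of `G` cannot diverge at twice an exponent bounding that of `H`. -/
theorem Separators.tsum_ne_top (E : Separators H l) (hl : IsProperLength l) (hnorm : H.Normal)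
    {f h : G} (hf : ∀ n : ℤ, n ≠ 0 → f ^ n ≠ 1) (hh : h ∉ commensurating f) {s₀ : ℝ}
    (hs₀ : 0 ≤ s₀) (hH : ∀ s > s₀, ∑' h : H, eexp (-s * l h) ≠ ∞) :
    ∑' g, eexp (-(2 * s₀) * l g) ≠ ∞ := by
  intro hG
  obtain ⟨C, hC, hA⟩ := E.exists_tsum_annulus_le hl hnorm hs₀ hG hH
  rcases hs₀.eq_or_lt with rfl | hs₀
  · obtain ⟨m, hm⟩ := ENNReal.exists_nat_gt hC
    obtain ⟨n, hn⟩ := exists_lt_encard_annulus hl hf hh m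
    refine absurd ((hA n).trans hm.le) (not_le.2 ?_)
    simp only [neg_zero, zero_mul]
    rw [ENNReal.tsum_set_const, eexp, Real.exp_zero, ENNReal.ofReal_one, mul_one]
    exact_mod_cast ENat.toENNReal_lt.2 hn
  · refine absurd hG (ne_top_of_le_ne_top
      (ENNReal.mul_ne_top hC (tsum_eexp_nat_ne_top hs₀)) ?_)
    rw [← ENNReal.tsum_mul_left]
    refine tsum_le_tsum_annuli (l := l) fun n => ?_
    refine le_trans ?_ (mul_le_mul_left (hA n) _)
    rw [← ENNReal.tsum_mul_right]
    refine ENNReal.tsum_le_tsum fun g => ?_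
    have h1 := Nat.floor_le (hl.nonneg g)
    rw [show ⌊l g⌋₊ = n from g.2] at h1
    rw [← eexp_add]
    exact eexp_le (by nlinarith)

end Growth

section CriticalExponent

open scoped ENNReal

variable {Y : Type*} [MetricSpace Y] {G : Type*} [Group G] [MulAction G Y]

theorem orbitCount_mono (hprop : ProperAction G Y) (o : Y) {Γ Γ' : Set G} (hΓ : Γ ⊆ Γ') {R R' : ℝ}
    (hR : R ≤ R') : orbitCount G o Γ R ≤ orbitCount G o Γ' R' :=
  Nat.card_mono ((hprop.finite_dist_le o R').subset fun _ hg => hg.2)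
    fun _ hg => ⟨hΓ hg.1, hg.2.trans hR⟩

theorem orbitCount_pos (hprop : ProperAction G Y) (o : Y) (H : Subgroup G) {R : ℝ} (hR : 0 ≤ R) :
    0 < orbitCount G o (H : Set G) R := by
  have : Finite {g : G // g ∈ (H : Set G) ∧ dist o (g • o) ≤ R} :=
    ((hprop.finite_dist_le o R).subset fun _ hg => hg.2 : {g : G | g ∈ (H : Set G) ∧
      dist o (g • o) ≤ R}.Finite)
  have : Nonempty {g : G // g ∈ (H : Set G) ∧ dist o (g • o) ≤ R} :=
    ⟨1, H.one_mem, by simpa using hR⟩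
  exact Nat.card_pos

theorem encard_eq_orbitCount (hprop : ProperAction G Y) (o : Y) (H : Subgroup G) (R : ℝ) :
    {h : H | dist o ((h : G) • o) ≤ R}.encard = orbitCount G o (H : Set G) R := by
  have h1 : Subtype.val '' {h : H | dist o ((h : G) • o) ≤ R} =
      {g : G | g ∈ (H : Set G) ∧ dist o (g • o) ≤ R} := by
    ext g
    simp [and_comm]
  rw [← Subtype.val_injective.encard_image, h1,
    ← ((hprop.finite_dist_le o R).subset fun _ hg => hg.2).cast_ncard_eq]
  rfl

theorem isBoundedUnder_log_orbitCount (hprop : ProperAction G Y) {o : Y}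
    (hbdd : Filter.IsBoundedUnder (· ≤ ·) atTop
      (fun R : ℝ => Real.log (orbitCount G o (Set.univ : Set G) R) / R)) (H : Subgroup G) :
    Filter.IsBoundedUnder (· ≤ ·) atTop
      (fun R : ℝ => Real.log (orbitCount G o (H : Set G) R) / R) := by
  refine hbdd.mono_le ?_
  filter_upwards [eventually_ge_atTop 0] with R hR
  gcongr
  · exact_mod_cast orbitCount_pos hprop o H hR
  · exact orbitCount_mono hprop o (subset_univ _) le_rfl

theorem critExp_nonneg (hprop : ProperAction G Y) {o : Y}
    (hbdd : Filter.IsBoundedUnder (· ≤ ·) atTop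
      (fun R : ℝ => Real.log (orbitCount G o (Set.univ : Set G) R) / R)) (H : Subgroup G) :
    0 ≤ critExp G o (H : Set G) := by
  refine Filter.le_limsup_of_frequently_le (Filter.Eventually.frequently ?_)
    (isBoundedUnder_log_orbitCount hprop hbdd H)
  filter_upwards [eventually_ge_atTop 0] with R hR
  exact div_nonneg (Real.log_natCast_nonneg _) hR

theorem tsum_ne_top_of_critExp_lt (hprop : ProperAction G Y) {o : Y}
    (hbdd : Filter.IsBoundedUnder (· ≤ ·) atTop
      (fun R : ℝ => Real.log (orbitCount G o (Set.univ : Set G) R) / R)) (H : Subgroup G) {s : ℝ}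
    (hs : critExp G o (H : Set G) < s) :
    ∑' h : H, eexp (-s * dist o ((h : G) • o)) ≠ ∞ := by
  have h0 := critExp_nonneg hprop hbdd H
  obtain ⟨s', h1, h2⟩ := exists_between hs
  have h3 := Filter.eventually_lt_of_limsup_lt h1 (isBoundedUnder_log_orbitCount hprop hbdd H)
  obtain ⟨R₀, hR₀⟩ := Filter.eventually_atTop.1 (h3.and (eventually_gt_atTop 0))
  refine tsum_eexp_ne_top (l := fun h : H => dist o ((h : G) • o)) (fun _ => dist_nonneg)
    (D := (orbitCount G o (H : Set G) R₀ + 1 : ℕ)) (ENNReal.natCast_ne_top _)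
    (h0.trans hs.le) h2 fun n => ?_
  rw [encard_eq_orbitCount hprop, ENat.toENNReal_coe]
  have hone : 1 ≤ eexp (s' * n) := by
    rw [eexp, ENNReal.one_le_ofReal, Real.one_le_exp_iff]
    exact mul_nonneg (h0.trans h1.le) (Nat.cast_nonneg n)
  rcases le_total (n : ℝ) R₀ with h | h
  · refine le_mul_of_le_of_one_le ?_ hone
    exact_mod_cast (orbitCount_mono hprop o subset_rfl h).trans (Nat.le_succ _)
  · obtain ⟨h4, h5⟩ := hR₀ n h
    refine le_trans ?_ (le_mul_of_one_le_left' (by simp))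
    rw [div_lt_iff₀ h5, Real.log_lt_iff_lt_exp
      (by exact_mod_cast orbitCount_pos hprop o H h5.le)] at h4
    rw [eexp, ← ENNReal.ofReal_natCast]
    exact ENNReal.ofReal_le_ofReal h4.le

end CriticalExponent

/-- co-growth of normal subgroups: if the action of `G` (with a contracting
element) is of divergent type, then every infinite normal subgroup `H ≤ G` satisfies
`ω_H > ω_G / 2`. -/
theorem statement19 {Y G : Type*} [MetricSpace Y] [ProperSpace Y]
    [Group G] [MulAction G Y] [Countable G]
    (hY : GeodesicSpace Y) (hiso : IsometricAction G Y)
    (hprop : ProperAction G Y) (hne : NonElementary G) (o : Y)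
    (hcontr : ∃ f : G, IsContractingEltAny o f)
    (hbdd : Filter.IsBoundedUnder (· ≤ ·) atTop
      (fun R : ℝ => Real.log (orbitCount G o (Set.univ : Set G) R) / R))
    (hdiv : ¬ Summable (fun g : G =>
      Real.exp (-(critExp G o (Set.univ : Set G)) * dist o (g • o))))
    (H : Subgroup G) (hnorm : H.Normal) (hinf : (H : Set G).Infinite) :
    critExp G o (Set.univ : Set G) / 2 < critExp G o (H : Set G) := by
  have : IsIsometricSMul G Y := ⟨hiso⟩
  obtain ⟨f, C, hC, hf⟩ := hcontr
  have hC0 : 0 ≤ C := by linarith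
  obtain ⟨E⟩ := hf.nonempty_separators hY hprop hne hC0 hnorm hinf
  obtain ⟨h, -, hh⟩ := hf.exists_mem_notMem_commensurating hY hprop hne hC0 hnorm hinf
  by_contra! hle
  refine E.tsum_ne_top (isProperLength_dist hprop o) hnorm hf.1 hh
    ((critExp_nonneg hprop hbdd H).trans hle)
    (fun s hs => tsum_ne_top_of_critExp_lt hprop hbdd H (hle.trans_lt hs)) ?_
  by_contra hfin
  refine hdiv ((ENNReal.summable_toReal hfin).congr fun g => ?_)
  rw [eexp, ENNReal.toReal_ofReal (Real.exp_pos _).le, mul_div_cancel₀ _ two_ne_zero]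

end ConfDyn
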